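/- Let R₂ = 32π⁴/(3(1+√2)⁴). Let u be an admissible solution of the vorticity equation on [0,T) with viscosity ν > 0, with ω = ∇×u and ω_h = (ω₁, ω₂, 0). Then for every t ∈ [0,T), the function t ↦ ‖ω_h(t,·)‖²_{Ḣ^{−1/2}} is differentiable at t with derivative at most (1/(R₂ ν³)) ‖ω(t,·)‖⁴_{L²(ℝ³)} ‖ω_h(t,·)‖²_{Ḣ^{−1/2}}. -/

import Mathlib

open MeasureTheory Real SchwartzMap
open scoped FourierTransform ENNReal

noncomputable section

/-- Euclidean three-space. -/
abbrev E3 : Type := EuclideanSpace ℝ (Fin 3)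

/-- The `i`-th standard basis vector. -/
def ee (i : Fin 3) : E3 := EuclideanSpace.single i 1

/-- The partial derivative `∂ᵢ f`. -/
def pd (i : Fin 3) (f : E3 → ℝ) : E3 → ℝ := fun x => fderiv ℝ f x (ee i)

/-- The Fourier transform (kernel `e^{-2πi x·ξ}`) of a real-valued function. -/
def ft (f : E3 → ℝ) : E3 → ℂ := 𝓕 (fun x => (f x : ℂ))

/-- The squared homogeneous Sobolev norm `‖v‖²_{Ḣ^s}` of a vector field. -/
def hsV (s : ℝ) (v : Fin 3 → E3 → ℝ) : ℝ :=
  ∫ ξ : E3, (2 * π * ‖ξ‖) ^ (2 * s) * ∑ i, ‖ft (v i) ξ‖ ^ 2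

/-- The curl `ω = ∇ × u` of a vector field. -/
def curl (u : Fin 3 → E3 → ℝ) : Fin 3 → E3 → ℝ :=
  ![fun x => pd 1 (u 2) x - pd 2 (u 1) x,
    fun x => pd 2 (u 0) x - pd 0 (u 2) x,
    fun x => pd 0 (u 1) x - pd 1 (u 0) x]

/-- The strain tensor `S = (∇u + (∇u)ᵀ)/2`. -/
def strain (u : Fin 3 → E3 → ℝ) : Fin 3 → Fin 3 → E3 → ℝ :=
  fun i j x => (pd i (u j) x + pd j (u i) x) / 2

/-- The time interval `[0,T)` for `T ∈ (0,∞]`. -/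
def timeSet (T : ℝ≥0∞) : Set ℝ := {t : ℝ | 0 ≤ t ∧ ENNReal.ofReal t < T}

/-- An admissible solution of the vorticity equation on `[0,T)` with viscosity `ν`:
`u` is jointly smooth, Schwartz in space at each time with time-locally uniform
Schwartz seminorm bounds (also for `∂ₜu`), divergence free, and its vorticity
`ω = ∇×u` satisfies `∂ₜω − νΔω + (u·∇)ω − Sω = 0` on `[0,T) × ℝ³`. -/
structure AdmissibleSolution (ν : ℝ) (T : ℝ≥0∞) where
  u : ℝ → Fin 3 → 𝓢(E3, ℝ)
  u' : ℝ → Fin 3 → 𝓢(E3, ℝ)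
  smooth : ∀ i : Fin 3,
    ContDiffOn ℝ (⊤ : ℕ∞) (fun p : ℝ × E3 => u p.1 i p.2) (timeSet T ×ˢ Set.univ)
  tderiv : ∀ t ∈ timeSet T, ∀ i : Fin 3, ∀ x : E3,
    HasDerivWithinAt (fun s => u s i x) (u' t i x) (timeSet T) t
  seminorm_bdd : ∀ K : Set ℝ, IsCompact K → K ⊆ timeSet T → ∀ k n : ℕ, ∀ i : Fin 3,
    ∃ C : ℝ, ∀ t ∈ K, SchwartzMap.seminorm ℝ k n (u t i) ≤ C ∧
      SchwartzMap.seminorm ℝ k n (u' t i) ≤ C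
  divfree : ∀ t ∈ timeSet T, ∀ x : E3, ∑ i, pd i (⇑(u t i)) x = 0
  vort_eq : ∀ t ∈ timeSet T, ∀ x : E3, ∀ k : Fin 3,
    derivWithin (fun s => curl (fun i => ⇑(u s i)) k x) (timeSet T) t
      - ν * (∑ i, pd i (pd i (curl (fun i => ⇑(u t i)) k)) x)
      + (∑ i, u t i x * pd i (curl (fun i => ⇑(u t i)) k) x)
      - (∑ j, strain (fun i => ⇑(u t i)) k j x * curl (fun i => ⇑(u t i)) j x) = 0

/-- The vorticity of an admissible solution at time `t`. -/
def AdmissibleSolution.vort {ν : ℝ} {T : ℝ≥0∞} (sol : AdmissibleSolution ν T)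
    (t : ℝ) : Fin 3 → E3 → ℝ :=
  curl (fun i => ⇑(sol.u t i))

/-- The horizontal part `ω_h = (ω₁, ω₂, 0)` of the vorticity. -/
def AdmissibleSolution.vorth {ν : ℝ} {T : ℝ≥0∞} (sol : AdmissibleSolution ν T)
    (t : ℝ) : Fin 3 → E3 → ℝ :=
  ![sol.vort t 0, sol.vort t 1, fun _ => 0]

/-- The enstrophy `E(t) = (1/2)‖ω(t,·)‖²_{L²}`. -/
def AdmissibleSolution.enstrophy {ν : ℝ} {T : ℝ≥0∞} (sol : AdmissibleSolution ν T)
    (t : ℝ) : ℝ :=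
  (1 / 2) * ∫ x : E3, ∑ k, (sol.vort t k x) ^ 2

/-- The constant `R₂ = 32π⁴/(3(1+√2)⁴)`. -/
def R₂ : ℝ := 32 * π ^ 4 / (3 * (1 + Real.sqrt 2) ^ 4)

section part_1
/-- complexification of a real Schwartz function -/
def cS : 𝓢(E3, ℝ) →L[ℝ] 𝓢(E3, ℂ) := SchwartzMap.postcompCLM Complex.ofRealCLM

lemma cS_apply (f : 𝓢(E3, ℝ)) (x : E3) : cS f x = (f x : ℂ) := rfl

/-- Fourier transform of a real Schwartz function as a complex Schwartz function -/
def FS (f : 𝓢(E3, ℝ)) : 𝓢(E3, ℂ) := 𝓕 (cS f)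

lemma ft_eq (f : 𝓢(E3, ℝ)) : ft ⇑f = ⇑(FS f) := by
  rw [FS, SchwartzMap.fourier_coe]; rfl

lemma FS_add (f g : 𝓢(E3, ℝ)) : FS (f + g) = FS f + FS g := by
  simp only [FS, map_add, FourierTransform.fourier_add]

lemma FS_smul (c : ℝ) (f : 𝓢(E3, ℝ)) : FS (c • f) = c • FS f := by
  simp only [FS, map_smul]
  exact FourierTransform.fourier_smul (R := ℝ) c (cS f)

/-- partial derivative as a Schwartz function -/
def DS (i : Fin 3) (f : 𝓢(E3, ℝ)) : 𝓢(E3, ℝ) := LineDeriv.lineDerivOp (ee i) f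

lemma DS_coe (i : Fin 3) (f : 𝓢(E3, ℝ)) : ⇑(DS i f) = pd i ⇑f := by
  ext x
  exact SchwartzMap.lineDerivOp_apply_eq_fderiv _ _ _

lemma inner_ee (ξ : E3) (i : Fin 3) : inner ℝ ξ (ee i) = ξ i := by
  simp [ee, EuclideanSpace.inner_single_right]

lemma FS_DS (i : Fin 3) (f : 𝓢(E3, ℝ)) (ξ : E3) :
    FS (DS i f) ξ = (2 * π * Complex.I) * (ξ i : ℂ) * FS f ξ := by
  have h1 : cS (DS i f) = LineDeriv.lineDerivOp (ee i) (cS f) := by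
    ext x
    rw [SchwartzMap.lineDerivOp_apply_eq_fderiv, cS_apply, DS_coe]
    have : HasFDerivAt (⇑(cS f)) (Complex.ofRealCLM ∘L fderiv ℝ f x) x :=
      Complex.ofRealCLM.hasFDerivAt.comp x (f.hasFDerivAt x)
    rw [this.fderiv]; rfl
  rw [FS, h1, SchwartzMap.fourier_lineDerivOp_eq]
  rw [smul_apply, SchwartzMap.smulLeftCLM_apply_apply (by fun_prop)]
  rw [inner_ee, FS]
  simp only [smul_eq_mul, Complex.real_smul]
  ring

/-- product of Schwartz functions -/
def mS (f g : 𝓢(E3, ℝ)) : 𝓢(E3, ℝ) := SchwartzMap.pairing (ContinuousLinearMap.mul ℝ ℝ) f g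

lemma mS_apply (f g : 𝓢(E3, ℝ)) (x : E3) : mS f g x = f x * g x := by
  simp [mS, SchwartzMap.pairing_apply_apply]

lemma FS_conj (f : 𝓢(E3, ℝ)) (ξ : E3) : FS f (-ξ) = (starRingEnd ℂ) (FS f ξ) := by
  rw [← ft_eq, ft, Real.fourier_eq, Real.fourier_eq, ← integral_conj]
  congr 1
  ext x
  simp only [inner_neg_right, neg_neg, Circle.smul_def, smul_eq_mul, map_mul, Complex.conj_ofReal]
  congr 1
  rw [← Circle.coe_inv_eq_conj, ← AddChar.map_neg_eq_inv, neg_neg]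

lemma FS_mS (f g : 𝓢(E3, ℝ)) (ξ : E3) :
    FS (mS f g) ξ = ∫ η, FS f (ξ - η) * FS g η := by
  have hneg : ∀ (F : 𝓢(E3, ℂ)) (x : E3), 𝓕 (𝓕 F) x = F (-x) := by
    intro F x
    have : 𝓕⁻ (𝓕 F) (-x) = F (-x) := by simp
    rw [← this, SchwartzMap.fourierInv_coe, SchwartzMap.fourier_coe, Real.fourierInv_eq_fourier_neg,
      neg_neg]
  have h1 := SchwartzMap.convolution_apply (ContinuousLinearMap.mul ℂ ℂ) (FS g) (FS f) ξ
  have h2 : ∫ η, FS f (ξ - η) * FS g η =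
      SchwartzMap.convolution (ContinuousLinearMap.mul ℂ ℂ) (FS g) (FS f) ξ := by
    rw [h1, MeasureTheory.convolution_def]
    congr 1
    ext η
    simp [mul_comm]
  rw [h2]
  have h3 : SchwartzMap.convolution (ContinuousLinearMap.mul ℂ ℂ) (FS g) (FS f) =
      𝓕⁻ (SchwartzMap.pairing (ContinuousLinearMap.mul ℂ ℂ) (𝓕 (FS g)) (𝓕 (FS f))) := rfl
  rw [h3, SchwartzMap.fourierInv_coe, Real.fourierInv_eq_fourier_comp_neg, ← ft_eq, ft]
  refine congrFun (congrArg _ ?_) ξ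
  ext x
  rw [SchwartzMap.pairing_apply_apply, FS, FS, hneg, hneg, mS_apply, cS_apply, cS_apply, neg_neg]
  simp [mul_comm]

lemma plancherel (f : 𝓢(E3, ℝ)) : ∫ ξ, ‖FS f ξ‖ ^ 2 = ∫ x, f x ^ 2 := by
  rw [FS, SchwartzMap.integral_norm_sq_fourier]
  simp [cS_apply]
end part_1

section part_2
lemma hasDerivWithinAt_integral_dom {G : Type*} [NormedAddCommGroup G] [NormedSpace ℝ G]
    {K : Set ℝ} (hK : Convex ℝ K) (F F' : ℝ → E3 → G) (bound : E3 → ℝ)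
    (hb : Integrable bound)
    (hFi : ∀ s ∈ K, Integrable (F s))
    (hd : ∀ s ∈ K, ∀ x, HasDerivWithinAt (fun r => F r x) (F' s x) K s)
    (hbd : ∀ s ∈ K, ∀ x, ‖F' s x‖ ≤ bound x) (t : ℝ) (ht : t ∈ K) :
    HasDerivWithinAt (fun s => ∫ x, F s x) (∫ x, F' t x) K t := by
  rw [hasDerivWithinAt_iff_tendsto_slope]
  have h1 : Filter.Tendsto (fun s => ∫ x, slope (fun r => F r x) t s) (nhdsWithin t (K \ {t}))
      (nhds (∫ x, F' t x)) := by
    refine tendsto_integral_filter_of_dominated_convergence bound ?_ ?_ hb ?_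
    · filter_upwards [self_mem_nhdsWithin] with s hs
      simp only [slope_def_module]
      exact (((hFi s hs.1).sub (hFi t ht)).smul (s - t)⁻¹).aestronglyMeasurable
    · filter_upwards [self_mem_nhdsWithin] with s hs
      refine Filter.Eventually.of_forall fun x => ?_
      have := hK.norm_image_sub_le_of_norm_hasDerivWithin_le (f := fun r => F r x)
        (fun r hr => hd r hr x) (fun r hr => hbd r hr x) ht hs.1
      rw [slope_def_module, norm_smul, norm_inv]
      have hne : 0 < ‖s - t‖ := norm_pos_iff.2 (sub_ne_zero.2 hs.2)
      rw [inv_mul_le_iff₀ hne, mul_comm]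
      exact this
    · exact Filter.Eventually.of_forall fun x => hasDerivWithinAt_iff_tendsto_slope.1 (hd t ht x)
  refine h1.congr' ?_
  filter_upwards [self_mem_nhdsWithin] with s hs
  simp only [slope_def_module]
  rw [integral_smul, integral_sub (hFi s hs.1) (hFi t ht)]

/-- integrable weight -/
def wt (x : E3) : ℝ := (1 + ‖x‖) ^ (-4 : ℝ)

lemma wt_integrable : Integrable wt := by
  refine integrable_one_add_norm ?_
  simp; norm_num

lemma wt_pos (x : E3) : 0 < wt x := by unfold wt; positivity

lemma wt_eq (x : E3) : wt x = ((1 + ‖x‖) ^ 4)⁻¹ := by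
  unfold wt
  rw [Real.rpow_neg (by positivity)]
  norm_num

lemma schwartz_bd {G : Type*} [NormedAddCommGroup G] [NormedSpace ℝ G] (k : ℕ) (f : 𝓢(E3, G))
    {C : ℝ} (h : ∀ j ≤ k, SchwartzMap.seminorm ℝ j 0 f ≤ C) (x : E3) :
    (1 + ‖x‖) ^ k * ‖f x‖ ≤ 2 ^ k * C := by
  rw [add_comm, add_pow, Finset.sum_mul]
  have : (2:ℝ) ^ k * C = ∑ i ∈ Finset.range (k+1), (k.choose i : ℝ) * C := by
    rw [← Finset.sum_mul]
    congr 1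
    exact_mod_cast (Nat.sum_range_choose k).symm
  rw [this]
  refine Finset.sum_le_sum fun i hi => ?_
  have h1 := (SchwartzMap.norm_pow_mul_le_seminorm ℝ f i x).trans
    (h i (by simpa [Nat.lt_succ_iff] using hi))
  simp only [one_pow, mul_one]
  calc ‖x‖ ^ i * (k.choose i : ℝ) * ‖f x‖ = (k.choose i : ℝ) * (‖x‖ ^ i * ‖f x‖) := by ring
    _ ≤ _ := by gcongr

lemma bdd_FS {ι : Type*} (f : ι → 𝓢(E3, ℝ))
    (h : ∀ k n : ℕ, ∃ C : ℝ, ∀ a, SchwartzMap.seminorm ℝ k n (f a) ≤ C) (k n : ℕ) :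
    ∃ C : ℝ, ∀ a, SchwartzMap.seminorm ℝ k n (FS (f a)) ≤ C := by
  have h1 : Bornology.IsVonNBounded ℝ (Set.range f) := by
    rw [(schwartz_withSeminorms ℝ E3 ℝ).isVonNBounded_iff_seminorm_bounded]
    rintro ⟨k, n⟩
    obtain ⟨C, hC⟩ := h k n
    refine ⟨|C| + 1, by positivity, ?_⟩
    rintro _ ⟨a, rfl⟩
    exact lt_of_le_of_lt ((hC a).trans (le_abs_self C)) (lt_add_one _)
  have h2 := h1.image ((FourierTransform.fourierCLM ℝ 𝓢(E3, ℂ)) ∘L cS)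
  rw [(schwartz_withSeminorms ℝ E3 ℂ).isVonNBounded_iff_seminorm_bounded] at h2
  obtain ⟨r, _, hr⟩ := h2 (k, n)
  refine ⟨r, fun a => (hr _ ⟨f a, ⟨a, rfl⟩, rfl⟩).le⟩

lemma bdd_decay {ι G : Type*} [NormedAddCommGroup G] [NormedSpace ℝ G] (f : ι → 𝓢(E3, G))
    (h : ∀ k n : ℕ, ∃ C : ℝ, ∀ a, SchwartzMap.seminorm ℝ k n (f a) ≤ C) (k : ℕ) :
    ∃ C : ℝ, 0 ≤ C ∧ ∀ a x, (1 + ‖x‖) ^ k * ‖f a x‖ ≤ C := by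
  choose C hC using fun j => h j 0
  refine ⟨2 ^ k * ∑ j ∈ Finset.range (k+1), |C j|, by positivity, fun a x => ?_⟩
  refine schwartz_bd k (f a) (fun j hj => ?_) x
  refine (hC j a).trans ((le_abs_self _).trans ?_)
  exact Finset.single_le_sum (f := fun j => |C j|) (fun _ _ => abs_nonneg _)
    (Finset.mem_range.2 (Nat.lt_succ_of_le hj))

lemma timeSet_nhds {T : ℝ≥0∞} {t : ℝ} (ht : t ∈ timeSet T) :
    ∃ t1, t < t1 ∧ Set.Icc 0 t1 ⊆ timeSet T := by
  obtain ⟨h0, hT⟩ := ht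
  obtain ⟨r, hr1, hr2⟩ := ENNReal.lt_iff_exists_nnreal_btwn.1 hT
  refine ⟨r, ?_, ?_⟩
  · have := (ENNReal.ofReal_lt_iff_lt_toReal h0 ENNReal.coe_ne_top).1 hr1
    simpa using this
  · rintro s ⟨hs0, hs1⟩
    refine ⟨hs0, lt_of_le_of_lt ?_ hr2⟩
    rw [← ENNReal.ofReal_coe_nnreal]
    exact ENNReal.ofReal_le_ofReal hs1

lemma Icc_nhds {T : ℝ≥0∞} {t t1 : ℝ} (ht : t ∈ timeSet T) (h1 : t < t1) :
    Set.Icc 0 t1 ∈ nhdsWithin t (timeSet T) := by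
  have : Set.Iio t1 ∈ nhdsWithin t (timeSet T) := mem_nhdsWithin_of_mem_nhds (Iio_mem_nhds h1)
  filter_upwards [this, self_mem_nhdsWithin] with s hs hs'
  exact ⟨hs'.1, le_of_lt hs⟩

lemma HasDerivWithinAt.up {G : Type*} [NormedAddCommGroup G] [NormedSpace ℝ G] {f : ℝ → G} {f' : G}
    {T : ℝ≥0∞} {t t1 : ℝ} (ht : t ∈ timeSet T) (h1 : t < t1)
    (h : HasDerivWithinAt f f' (Set.Icc 0 t1) t) : HasDerivWithinAt f f' (timeSet T) t := by
  exact h.mono_of_mem_nhdsWithin (Icc_nhds ht h1)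

section
variable {ν : ℝ} {T : ℝ≥0∞} (sol : AdmissibleSolution ν T)

lemma sol_bdd {t1 : ℝ} (hK : Set.Icc 0 t1 ⊆ timeSet T) (i : Fin 3) (k : ℕ) :
    ∃ C : ℝ, 0 ≤ C ∧ ∀ s ∈ Set.Icc 0 t1, ∀ x : E3,
      (1 + ‖x‖) ^ k * ‖sol.u s i x‖ ≤ C ∧ (1 + ‖x‖) ^ k * ‖sol.u' s i x‖ ≤ C ∧
      (1 + ‖x‖) ^ k * ‖FS (sol.u s i) x‖ ≤ C ∧ (1 + ‖x‖) ^ k * ‖FS (sol.u' s i) x‖ ≤ C := by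
  have h1 : ∀ k n : ℕ, ∃ C : ℝ, ∀ a : Set.Icc 0 t1, SchwartzMap.seminorm ℝ k n (sol.u a i) ≤ C :=
    fun k n => by
      obtain ⟨C, hC⟩ := sol.seminorm_bdd _ isCompact_Icc hK k n i
      exact ⟨C, fun a => (hC a a.2).1⟩
  have h2 : ∀ k n : ℕ, ∃ C : ℝ, ∀ a : Set.Icc 0 t1, SchwartzMap.seminorm ℝ k n (sol.u' a i) ≤ C :=
    fun k n => by
      obtain ⟨C, hC⟩ := sol.seminorm_bdd _ isCompact_Icc hK k n i
      exact ⟨C, fun a => (hC a a.2).2⟩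
  obtain ⟨C1, p1, q1⟩ := bdd_decay _ h1 k
  obtain ⟨C2, p2, q2⟩ := bdd_decay _ h2 k
  obtain ⟨C3, p3, q3⟩ := bdd_decay _ (bdd_FS _ h1) k
  obtain ⟨C4, p4, q4⟩ := bdd_decay _ (bdd_FS _ h2) k
  refine ⟨C1 + C2 + C3 + C4, by positivity, fun s hs x => ⟨?_, ?_, ?_, ?_⟩⟩
  · linarith [q1 ⟨s, hs⟩ x]
  · linarith [q2 ⟨s, hs⟩ x]
  · linarith [q3 ⟨s, hs⟩ x]
  · linarith [q4 ⟨s, hs⟩ x]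

lemma le_wt {a C : ℝ} {x : E3} (h : (1 + ‖x‖) ^ 4 * a ≤ C) : a ≤ C * wt x := by
  rw [wt_eq, ← div_eq_mul_inv, le_div_iff₀ (by positivity), mul_comm]
  exact h

lemma FS_deriv {t1 : ℝ} (hK : Set.Icc 0 t1 ⊆ timeSet T) (i : Fin 3) (ξ : E3) (t : ℝ)
    (ht : t ∈ Set.Icc 0 t1) :
    HasDerivWithinAt (fun s => FS (sol.u s i) ξ) (FS (sol.u' t i) ξ) (Set.Icc 0 t1) t := by
  obtain ⟨C, _, hC⟩ := sol_bdd sol hK i 4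
  simp only [← ft_eq, ft, Real.fourier_eq]
  refine hasDerivWithinAt_integral_dom (convex_Icc _ _)
    (fun s x => Real.fourierChar (-inner ℝ x ξ) • ((sol.u s i x : ℝ) : ℂ))
    (fun s x => Real.fourierChar (-inner ℝ x ξ) • ((sol.u' s i x : ℝ) : ℂ)) (fun x => C * wt x)
    (wt_integrable.const_mul _) ?_ ?_ ?_ t ht
  · intro s hs
    exact (Real.fourierIntegral_convergent_iff (V := E3) (E := ℂ) (μ := volume)
      (f := fun x => ((sol.u s i x : ℝ) : ℂ)) ξ).2 (sol.u s i).integrable.ofReal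
  · intro s hs x
    have h := (sol.tderiv s (hK hs) i x).mono hK
    have h2 : HasDerivWithinAt (fun r => ((sol.u r i x : ℝ) : ℂ)) ((sol.u' s i x : ℝ) : ℂ)
      (Set.Icc 0 t1) s := h.ofReal_comp
    exact h2.const_smul _
  · intro s hs x
    rw [Circle.norm_smul, Complex.norm_real]
    exact le_wt (hC s hs x).2.1

lemma pd_deriv {t1 : ℝ} (hK : Set.Icc 0 t1 ⊆ timeSet T) (i j : Fin 3) (x : E3) (t : ℝ)
    (ht : t ∈ Set.Icc 0 t1) :
    HasDerivWithinAt (fun s => pd j (sol.u s i) x) (pd j (sol.u' t i) x) (Set.Icc 0 t1) t := by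
  obtain ⟨C, hC0, hC⟩ := sol_bdd sol hK i 5
  have key : ∀ f : 𝓢(E3, ℝ), pd j f x =
      (∫ ξ, (Real.fourierChar (inner ℝ ξ x)) • ((2 * π * Complex.I) * (ξ j : ℂ) * FS f ξ)).re := by
    intro f
    have h1 : 𝓕⁻ (FS (DS j f)) x = cS (DS j f) x := by simp [FS]
    rw [SchwartzMap.fourierInv_coe, Real.fourierInv_eq] at h1
    simp only [FS_DS] at h1
    rw [h1, cS_apply, Complex.ofReal_re, DS_coe]
  simp only [key]
  refine (Complex.reCLM.hasFDerivAt.comp_hasDerivWithinAt t (hasDerivWithinAt_integral_dom (convex_Icc _ _)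
    (fun s ξ => (Real.fourierChar (inner ℝ ξ x)) • ((2 * π * Complex.I) * (ξ j : ℂ) * FS (sol.u s i) ξ))
    (fun s ξ => (Real.fourierChar (inner ℝ ξ x)) • ((2 * π * Complex.I) * (ξ j : ℂ) * FS (sol.u' s i) ξ))
    (fun x => (2 * π * C) * wt x)
    (wt_integrable.const_mul _) ?_ ?_ ?_ t ht))
  · intro s hs
    simp only [← FS_DS]
    have := (Real.fourierIntegral_convergent_iff (V := E3) (E := ℂ) (μ := volume)
      (f := FS (DS j (sol.u s i))) (-x)).2
      (SchwartzMap.integrable _)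
    simpa using this
  · intro s hs ξ
    exact ((FS_deriv sol hK i ξ s hs).const_mul _).const_smul _
  · intro s hs ξ
    rw [Circle.norm_smul]
    refine le_wt ?_
    have h1 := (hC s hs ξ).2.2.2
    have h2 : ‖ξ j‖ ≤ 1 + ‖ξ‖ := by
      have := EuclideanSpace.norm_eq ξ
      linarith [PiLp.norm_apply_le ξ j]
    simp only [norm_mul, Complex.norm_real, Complex.norm_I, Complex.norm_ofNat, mul_one]
    rw [Real.norm_of_nonneg pi_pos.le]
    calc (1 + ‖ξ‖)^4 * (2 * π * ‖ξ j‖ * ‖FS (sol.u' s i) ξ‖)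
        ≤ (1 + ‖ξ‖)^4 * (2 * π * (1 + ‖ξ‖) * ‖FS (sol.u' s i) ξ‖) := by gcongr
      _ = 2 * π * ((1 + ‖ξ‖)^5 * ‖FS (sol.u' s i) ξ‖) := by ring
      _ ≤ _ := by gcongr
end
end part_2

section part_3
/-- curl of Schwartz fields -/
def curlS (u : Fin 3 → 𝓢(E3, ℝ)) : Fin 3 → 𝓢(E3, ℝ) :=
  ![DS 1 (u 2) - DS 2 (u 1), DS 2 (u 0) - DS 0 (u 2), DS 0 (u 1) - DS 1 (u 0)]

/-- strain of Schwartz fields -/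
def strainS (u : Fin 3 → 𝓢(E3, ℝ)) (i j : Fin 3) : 𝓢(E3, ℝ) :=
  (1 / 2 : ℝ) • (DS i (u j) + DS j (u i))

lemma curlS_coe (u : Fin 3 → 𝓢(E3, ℝ)) (k : Fin 3) :
    curl (fun i => ⇑(u i)) k = ⇑(curlS u k) := by
  fin_cases k <;> ext x <;> simp [curl, curlS, DS_coe]

lemma strainS_coe (u : Fin 3 → 𝓢(E3, ℝ)) (i j : Fin 3) (x : E3) :
    strain (fun i => ⇑(u i)) i j x = strainS u i j x := by
  simp [strain, strainS, DS_coe]; ring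

lemma FS_sub (f g : 𝓢(E3, ℝ)) : FS (f - g) = FS f - FS g := by
  have h := FS_add (f - g) g
  rw [sub_add_cancel] at h
  rw [h, add_sub_cancel_right]

/-- symbol of curl -/
def Om (V : Fin 3 → ℂ) (ξ : E3) : Fin 3 → ℂ :=
  ![(2 * π * Complex.I) * ((ξ 1 : ℂ) * V 2 - (ξ 2 : ℂ) * V 1),
    (2 * π * Complex.I) * ((ξ 2 : ℂ) * V 0 - (ξ 0 : ℂ) * V 2),
    (2 * π * Complex.I) * ((ξ 0 : ℂ) * V 1 - (ξ 1 : ℂ) * V 0)]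

lemma FS_curl (u : Fin 3 → 𝓢(E3, ℝ)) (k : Fin 3) (ξ : E3) :
    FS (curlS u k) ξ = Om (fun i => FS (u i) ξ) ξ k := by
  fin_cases k <;> simp [curlS, Om, FS_sub, FS_DS] <;> ring

lemma FS_strain (u : Fin 3 → 𝓢(E3, ℝ)) (i j : Fin 3) (ξ : E3) :
    FS (strainS u i j) ξ =
      (π * Complex.I) * ((ξ i : ℂ) * FS (u j) ξ + (ξ j : ℂ) * FS (u i) ξ) := by
  simp [strainS, FS_smul, FS_add, FS_DS]; ring

lemma coord_le (ξ : E3) (i : Fin 3) : |ξ i| ≤ ‖ξ‖ := PiLp.norm_apply_le ξ i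

lemma Om_norm (V : Fin 3 → ℂ) (ξ : E3) (k : Fin 3) :
    ‖Om V ξ k‖ ≤ 2 * π * ‖ξ‖ * ∑ i, ‖V i‖ := by
  have aux : ∀ a b i j, ‖(2 * π * Complex.I) * ((ξ a : ℂ) * V i - (ξ b : ℂ) * V j)‖ ≤
      2 * π * ‖ξ‖ * (‖V i‖ + ‖V j‖) := by
    intro a b i j
    rw [norm_mul]
    have h1 : ‖(2 * π * Complex.I : ℂ)‖ = 2 * π := by
      simp [abs_of_pos pi_pos]
    have h2 : ‖(ξ a : ℂ) * V i - (ξ b : ℂ) * V j‖ ≤ ‖ξ‖ * ‖V i‖ + ‖ξ‖ * ‖V j‖ := by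
      refine (norm_sub_le _ _).trans ?_
      rw [norm_mul, norm_mul, Complex.norm_real, Complex.norm_real]
      gcongr
      · exact coord_le ξ a
      · exact coord_le ξ b
    rw [h1]
    calc 2 * π * ‖(ξ a : ℂ) * V i - (ξ b : ℂ) * V j‖ ≤ 2 * π * (‖ξ‖ * ‖V i‖ + ‖ξ‖ * ‖V j‖) := by gcongr
      _ = _ := by ring
  have h0 := norm_nonneg (V 0)
  have h1 := norm_nonneg (V 1)
  have h2 := norm_nonneg (V 2)
  fin_cases k
  · refine (aux 1 2 2 1).trans ?_
    rw [Fin.sum_univ_three]; refine mul_le_mul_of_nonneg_left ?_ (by positivity); linarith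
  · refine (aux 2 0 0 2).trans ?_
    rw [Fin.sum_univ_three]; refine mul_le_mul_of_nonneg_left ?_ (by positivity); linarith
  · refine (aux 0 1 1 0).trans ?_
    rw [Fin.sum_univ_three]; refine mul_le_mul_of_nonneg_left ?_ (by positivity); linarith

lemma Om_div_norm (V : Fin 3 → ℂ) (ξ : E3) (k : Fin 3) :
    (2 * π * ‖ξ‖)⁻¹ * ‖Om V ξ k‖ ≤ ∑ i, ‖V i‖ := by
  rcases eq_or_lt_of_le (norm_nonneg ξ) with h | h
  · rw [← h]; simp; positivity
  · rw [inv_mul_le_iff₀ (by positivity)]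
    exact Om_norm V ξ k

lemma rpow_w (ξ : E3) : (2 * π * ‖ξ‖) ^ (2 * (-(1 / 2)) : ℝ) = (2 * π * ‖ξ‖)⁻¹ := by
  norm_num
  rw [Real.rpow_neg_one, mul_inv, mul_inv]; ring

/-- squared modulus of horizontal vorticity -/
def W2 (u : Fin 3 → 𝓢(E3, ℝ)) (ξ : E3) : ℝ :=
  ‖FS (curlS u 0) ξ‖ ^ 2 + ‖FS (curlS u 1) ξ‖ ^ 2

lemma inner_abs_le (a b : ℂ) : |inner ℝ a b| ≤ ‖a‖ * ‖b‖ := abs_real_inner_le_norm a b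

lemma weighted_integrable (u : Fin 3 → 𝓢(E3, ℝ)) (k : Fin 3) (g : 𝓢(E3, ℂ)) :
    Integrable (fun ξ => (2 * π * ‖ξ‖)⁻¹ * inner ℝ (FS (curlS u k) ξ) (g ξ)) := by
  have hV : ∀ i, ∃ C, ∀ ξ, ‖FS (u i) ξ‖ ≤ C := fun i =>
    ⟨_, fun ξ => SchwartzMap.norm_le_seminorm ℝ (FS (u i)) ξ⟩
  choose C hC using hV
  refine Integrable.mono' (g := fun ξ => (∑ i, C i) * ‖g ξ‖) (g.integrable.norm.const_mul _) ?_ ?_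
  · refine AEStronglyMeasurable.mul (by fun_prop) ?_
    exact (Continuous.inner (𝕜 := ℝ) (FS (curlS u k)).continuous g.continuous).aestronglyMeasurable
  · refine Filter.Eventually.of_forall fun ξ => ?_
    rw [norm_mul, Real.norm_of_nonneg (by positivity), Real.norm_eq_abs]
    have h1 := inner_abs_le (FS (curlS u k) ξ) (g ξ)
    have h2 := Om_div_norm (fun i => FS (u i) ξ) ξ k
    rw [← FS_curl] at h2
    calc (2 * π * ‖ξ‖)⁻¹ * |inner ℝ (FS (curlS u k) ξ) (g ξ)|
        ≤ (2 * π * ‖ξ‖)⁻¹ * (‖FS (curlS u k) ξ‖ * ‖g ξ‖) := by gcongr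
      _ = ((2 * π * ‖ξ‖)⁻¹ * ‖FS (curlS u k) ξ‖) * ‖g ξ‖ := by ring
      _ ≤ (∑ i, C i) * ‖g ξ‖ := by
          gcongr
          exact h2.trans (Finset.sum_le_sum fun i _ => hC i ξ)

section
variable {ν : ℝ} {T : ℝ≥0∞} (sol : AdmissibleSolution ν T)

lemma hsV_eq (s : ℝ) : hsV (-(1 / 2)) (sol.vorth s) = ∫ ξ, (2 * π * ‖ξ‖)⁻¹ * W2 (sol.u s) ξ := by
  unfold hsV
  congr 1
  ext ξ
  rw [rpow_w, Fin.sum_univ_three]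
  have h2 : ft (sol.vorth s 2) ξ = 0 := by
    have : sol.vorth s 2 = fun _ => 0 := rfl
    rw [this, ft, Real.fourier_eq]; simp
  have h0 : sol.vorth s 0 = ⇑(curlS (sol.u s) 0) := curlS_coe (sol.u s) 0
  have h1 : sol.vorth s 1 = ⇑(curlS (sol.u s) 1) := curlS_coe (sol.u s) 1
  rw [h2, h0, h1, ft_eq, ft_eq, W2]
  simp

lemma W2_integrable (u : Fin 3 → 𝓢(E3, ℝ)) :
    Integrable (fun ξ => (2 * π * ‖ξ‖)⁻¹ * W2 u ξ) := by
  have h0 := weighted_integrable u 0 (FS (curlS u 0))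
  have h1 := weighted_integrable u 1 (FS (curlS u 1))
  refine (h0.add h1).congr (Filter.Eventually.of_forall fun ξ => ?_)
  simp only [Pi.add_apply, real_inner_self_eq_norm_sq, W2]; ring

lemma FScurl_deriv {t1 : ℝ} (hK : Set.Icc 0 t1 ⊆ timeSet T) (k : Fin 3) (ξ : E3) (t : ℝ)
    (ht : t ∈ Set.Icc 0 t1) :
    HasDerivWithinAt (fun s => FS (curlS (sol.u s) k) ξ) (FS (curlS (sol.u' t) k) ξ)
      (Set.Icc 0 t1) t := by
  have h := fun i => FS_deriv sol hK i ξ t ht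
  simp only [FS_curl]
  fin_cases k
  · exact (((h 2).const_mul _).sub ((h 1).const_mul _)).const_mul _
  · exact (((h 0).const_mul _).sub ((h 2).const_mul _)).const_mul _
  · exact (((h 1).const_mul _).sub ((h 0).const_mul _)).const_mul _

lemma hsV_deriv {t1 : ℝ} (hK : Set.Icc 0 t1 ⊆ timeSet T) (t : ℝ) (ht : t ∈ Set.Icc 0 t1) :
    HasDerivWithinAt (fun s => hsV (-(1 / 2)) (sol.vorth s))
      (∫ ξ, (2 * π * ‖ξ‖)⁻¹ * (2 * inner ℝ (FS (curlS (sol.u t) 0) ξ) (FS (curlS (sol.u' t) 0) ξ)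
        + 2 * inner ℝ (FS (curlS (sol.u t) 1) ξ) (FS (curlS (sol.u' t) 1) ξ))) (Set.Icc 0 t1) t := by
  simp only [hsV_eq]
  choose C hC0 hC using fun i => sol_bdd sol hK i 5
  have hS : 0 ≤ ∑ i, C i := Finset.sum_nonneg fun i _ => hC0 i
  refine hasDerivWithinAt_integral_dom (convex_Icc _ _)
    (fun s ξ => (2 * π * ‖ξ‖)⁻¹ * W2 (sol.u s) ξ)
    (fun s ξ => (2 * π * ‖ξ‖)⁻¹ * (2 * inner ℝ (FS (curlS (sol.u s) 0) ξ) (FS (curlS (sol.u' s) 0) ξ)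
        + 2 * inner ℝ (FS (curlS (sol.u s) 1) ξ) (FS (curlS (sol.u' s) 1) ξ)))
    (fun ξ => (8 * π * (∑ i, C i) ^ 2) * wt ξ)
    (wt_integrable.const_mul _) ?_ ?_ ?_ t ht
  · intro s hs; exact W2_integrable _
  · intro s hs ξ
    exact (((FScurl_deriv sol hK 0 ξ s hs).norm_sq).add
      ((FScurl_deriv sol hK 1 ξ s hs).norm_sq)).const_mul _
  · intro s hs ξ
    have hu : (1 + ‖ξ‖) ^ 5 * ∑ i, ‖FS (sol.u s i) ξ‖ ≤ ∑ i, C i := by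
      rw [Finset.mul_sum]
      exact Finset.sum_le_sum fun i _ => (hC i s hs ξ).2.2.1
    have hu' : (1 + ‖ξ‖) ^ 5 * ∑ i, ‖FS (sol.u' s i) ξ‖ ≤ ∑ i, C i := by
      rw [Finset.mul_sum]
      exact Finset.sum_le_sum fun i _ => (hC i s hs ξ).2.2.2
    have h1r : 1 ≤ 1 + ‖ξ‖ := by linarith [norm_nonneg ξ]
    set A := ∑ i, ‖FS (sol.u s i) ξ‖ with hA
    set B := ∑ i, ‖FS (sol.u' s i) ξ‖ with hB
    have hA0 : 0 ≤ A := Finset.sum_nonneg fun i _ => norm_nonneg _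
    have hB0 : 0 ≤ B := Finset.sum_nonneg fun i _ => norm_nonneg _
    have aux : ∀ k, (2 * π * ‖ξ‖)⁻¹ * |2 * inner ℝ (FS (curlS (sol.u s) k) ξ) (FS (curlS (sol.u' s) k) ξ)|
        ≤ 4 * π * (∑ i, C i) ^ 2 * wt ξ := by
      intro k
      refine le_wt ?_
      have h2 := Om_div_norm (fun i => FS (sol.u s i) ξ) ξ k
      have h3 := Om_norm (fun i => FS (sol.u' s i) ξ) ξ k
      rw [← FS_curl, ← hA] at h2
      rw [← FS_curl, ← hB] at h3
      have h4 := inner_abs_le (FS (curlS (sol.u s) k) ξ) (FS (curlS (sol.u' s) k) ξ)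
      have hA1 : A ≤ ∑ i, C i := by
        refine le_trans ?_ hu
        exact le_mul_of_one_le_left hA0 (one_le_pow₀ h1r)
      rw [abs_mul, abs_two]
      calc (1 + ‖ξ‖)^4 * ((2 * π * ‖ξ‖)⁻¹ * (2 * |inner ℝ (FS (curlS (sol.u s) k) ξ) (FS (curlS (sol.u' s) k) ξ)|))
          ≤ (1 + ‖ξ‖)^4 * ((2 * π * ‖ξ‖)⁻¹ * (2 * (‖FS (curlS (sol.u s) k) ξ‖ * ‖FS (curlS (sol.u' s) k) ξ‖))) := by gcongr
        _ = 2 * (1 + ‖ξ‖)^4 * (((2 * π * ‖ξ‖)⁻¹ * ‖FS (curlS (sol.u s) k) ξ‖) * ‖FS (curlS (sol.u' s) k) ξ‖) := by ring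
        _ ≤ 2 * (1 + ‖ξ‖)^4 * (A * (2 * π * ‖ξ‖ * B)) := by gcongr
        _ ≤ 2 * (1 + ‖ξ‖)^4 * (A * (2 * π * (1 + ‖ξ‖) * B)) := by gcongr; linarith
        _ = 4 * π * A * ((1 + ‖ξ‖)^5 * B) := by ring
        _ ≤ 4 * π * (∑ i, C i) * (∑ i, C i) := by gcongr
        _ = _ := by ring
    rw [mul_add, Real.norm_eq_abs]
    refine (abs_add_le _ _).trans ?_
    rw [abs_mul, abs_mul (_⁻¹), abs_of_nonneg (by positivity : 0 ≤ (2 * π * ‖ξ‖)⁻¹)]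
    linarith [aux 0, aux 1]

/-- the right-hand side of the vorticity equation -/
def NLS (ν : ℝ) (u : Fin 3 → 𝓢(E3, ℝ)) (k : Fin 3) : 𝓢(E3, ℝ) :=
  ν • (DS 0 (DS 0 (curlS u k)) + DS 1 (DS 1 (curlS u k)) + DS 2 (DS 2 (curlS u k)))
  - (mS (u 0) (DS 0 (curlS u k)) + mS (u 1) (DS 1 (curlS u k)) + mS (u 2) (DS 2 (curlS u k)))
  + (mS (strainS u k 0) (curlS u 0) + mS (strainS u k 1) (curlS u 1)
    + mS (curlS u 2) (strainS u k 2))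

lemma vort_eqS {t : ℝ} (ht : t ∈ timeSet T) (k : Fin 3) :
    curlS (sol.u' t) k = NLS ν (sol.u t) k := by
  obtain ⟨t1, h1, hK⟩ := timeSet_nhds ht
  have htK : t ∈ Set.Icc 0 t1 := ⟨ht.1, h1.le⟩
  ext x
  have hd : HasDerivWithinAt (fun s => curl (fun i => ⇑(sol.u s i)) k x)
      (curl (fun i => ⇑(sol.u' t i)) k x) (timeSet T) t := by
    refine HasDerivWithinAt.up ht h1 ?_
    have h := fun i j => pd_deriv sol hK i j x t htK
    fin_cases k
    · exact (h 2 1).sub (h 1 2)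
    · exact (h 0 2).sub (h 2 0)
    · exact (h 1 0).sub (h 0 1)
  have hu : UniqueDiffWithinAt ℝ (timeSet T) t :=
    (uniqueDiffOn_Icc (lt_of_le_of_lt ht.1 h1) t htK).mono hK
  have he := sol.vort_eq t ht x k
  rw [hd.derivWithin hu] at he
  simp only [curlS_coe, strainS_coe, ← DS_coe, Fin.sum_univ_three] at he
  simp only [NLS, add_apply, sub_apply, smul_apply, mS_apply, smul_eq_mul]
  linarith
end
end part_3

section part_4
lemma cs2 (a b c d : ℝ) : a * b + c * d ≤ √(a ^ 2 + c ^ 2) * √(b ^ 2 + d ^ 2) := by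
  rw [← Real.sqrt_mul (by positivity)]
  apply Real.le_sqrt_of_sq_le
  nlinarith [sq_nonneg (a * d - b * c)]

lemma bessel2 {H : Type*} [NormedAddCommGroup H] [InnerProductSpace ℂ H] (e v o : H)
    (h : inner ℂ e v = 0) :
    ‖v‖ ^ 2 * ‖inner ℂ e o‖ ^ 2 + ‖e‖ ^ 2 * ‖inner ℂ v o‖ ^ 2 ≤ ‖e‖ ^ 2 * ‖v‖ ^ 2 * ‖o‖ ^ 2 := by
  by_cases he : e = 0
  · simp [he]
  by_cases hv : v = 0
  · simp [hv]
  have he' : 0 < ‖e‖ := norm_pos_iff.mpr he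
  have hv' : 0 < ‖v‖ := norm_pos_iff.mpr hv
  have hon : Orthonormal ℂ (![((‖e‖⁻¹ : ℝ) : ℂ) • e, ((‖v‖⁻¹ : ℝ) : ℂ) • v] : Fin 2 → H) := by
    have h' : inner ℂ v e = 0 := by rw [← inner_conj_symm, h]; simp
    constructor
    · intro i
      fin_cases i <;> simp [norm_smul, he, hv]
    · intro i j hij
      fin_cases i <;> fin_cases j <;> simp_all [inner_smul_left, inner_smul_right]
  have hb := hon.sum_inner_products_le o (s := Finset.univ)
  simp only [Fin.sum_univ_two, Matrix.cons_val_zero, Matrix.cons_val_one, inner_smul_left,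
    norm_mul, Complex.conj_ofReal, Complex.norm_real, norm_inv, norm_norm] at hb
  have : ‖v‖ ^ 2 * ‖inner ℂ e o‖ ^ 2 + ‖e‖ ^ 2 * ‖inner ℂ v o‖ ^ 2 =
    ‖e‖ ^ 2 * ‖v‖ ^ 2 * ((‖e‖⁻¹ * ‖inner ℂ e o‖) ^ 2 + (‖v‖⁻¹ * ‖inner ℂ v o‖) ^ 2) := by
    field_simp
  rw [this]
  gcongr

lemma bilin_bd {H : Type*} [NormedAddCommGroup H] [InnerProductSpace ℂ H] (e v o p : H)
    (h : inner ℂ e v = 0) :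
    ‖inner ℂ e o‖ * ‖inner ℂ v p‖ + ‖inner ℂ v o‖ * ‖inner ℂ e p‖ ≤ ‖e‖ * ‖v‖ * ‖o‖ * ‖p‖ := by
  by_cases he : e = 0
  · simp [he]
  by_cases hv : v = 0
  · simp [hv]
  have he' : 0 < ‖e‖ := norm_pos_iff.mpr he
  have hv' : 0 < ‖v‖ := norm_pos_iff.mpr hv
  have h1 := bessel2 e v o h
  have h2 := bessel2 e v p h
  have h3 := cs2 (‖v‖ * ‖inner ℂ e o‖) (‖e‖ * ‖inner ℂ v p‖) (‖e‖ * ‖inner ℂ v o‖) (‖v‖ * ‖inner ℂ e p‖)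
  have h4 : √((‖v‖ * ‖inner ℂ e o‖) ^ 2 + (‖e‖ * ‖inner ℂ v o‖) ^ 2) ≤ ‖e‖ * ‖v‖ * ‖o‖ := by
    refine Real.sqrt_le_iff.mpr ⟨by positivity, ?_⟩
    linarith
  have h5 : √((‖e‖ * ‖inner ℂ v p‖) ^ 2 + (‖v‖ * ‖inner ℂ e p‖) ^ 2) ≤ ‖e‖ * ‖v‖ * ‖p‖ := by
    refine Real.sqrt_le_iff.mpr ⟨by positivity, ?_⟩
    linarith
  have h6 := h3.trans (mul_le_mul h4 h5 (by positivity) (by positivity))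
  refine le_of_mul_le_mul_left ?_ (mul_pos he' hv')
  linarith

/-- Euclidean complex three-space vectors -/
def vE (v : Fin 3 → ℂ) : EuclideanSpace ℂ (Fin 3) := WithLp.toLp 2 v

lemma vE_inner (v w : Fin 3 → ℂ) : inner ℂ (vE v) (vE w) =
    star (v 0) * w 0 + star (v 1) * w 1 + star (v 2) * w 2 := by
  simp [vE, PiLp.inner_apply, Fin.sum_univ_three, RCLike.inner_apply]; ring

lemma vE_norm (v : Fin 3 → ℂ) : ‖vE v‖ ^ 2 = ‖v 0‖ ^ 2 + ‖v 1‖ ^ 2 + ‖v 2‖ ^ 2 := by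
  simp [vE, EuclideanSpace.norm_sq_eq, Fin.sum_univ_three]

lemma vE_real (a : E3) : ‖vE (fun i => (a i : ℂ))‖ = ‖a‖ := by
  rw [← sq_eq_sq₀ (norm_nonneg _) (norm_nonneg _), vE_norm, EuclideanSpace.norm_sq_eq]
  simp [Fin.sum_univ_three]

lemma csq (z : ℂ) : ‖z‖ ^ 2 = z.re ^ 2 + z.im ^ 2 := by
  rw [← Complex.normSq_eq_norm_sq, Complex.normSq_apply]; ring

lemma norm_2piI : ‖(2 * π * Complex.I : ℂ)‖ = 2 * π := by simp [abs_of_pos pi_pos]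
lemma norm_piI : ‖(π * Complex.I : ℂ)‖ = π := by simp [abs_of_pos pi_pos]

lemma nsq_2piI (z : ℂ) : ‖(2 * π * Complex.I : ℂ) * z‖ ^ 2 = (2 * π) ^ 2 * (z.re ^ 2 + z.im ^ 2) := by
  rw [norm_mul, norm_2piI, mul_pow, csq]
lemma nsq_piI (z : ℂ) : ‖(π * Complex.I : ℂ) * z‖ ^ 2 = π ^ 2 * (z.re ^ 2 + z.im ^ 2) := by
  rw [norm_mul, norm_piI, mul_pow, csq]

/-- Lagrange identity -/
lemma Om_sq (v : Fin 3 → ℂ) (a : E3)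
    (h : (a 0 : ℂ) * v 0 + (a 1 : ℂ) * v 1 + (a 2 : ℂ) * v 2 = 0) :
    ‖Om v a 0‖ ^ 2 + ‖Om v a 1‖ ^ 2 + ‖Om v a 2‖ ^ 2 = (2 * π * ‖a‖ * ‖vE v‖) ^ 2 := by
  have hr := congrArg Complex.re h
  have hi := congrArg Complex.im h
  simp at hr hi
  rw [mul_pow, mul_pow _ ‖a‖, vE_norm, EuclideanSpace.norm_sq_eq, Fin.sum_univ_three]
  simp only [Om, Matrix.cons_val_zero, Matrix.cons_val_one, Matrix.cons_val,
    nsq_2piI, Real.norm_eq_abs, sq_abs]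
  simp only [csq]
  simp only [Complex.sub_re, Complex.sub_im, Complex.mul_re, Complex.mul_im, Complex.ofReal_re,
    Complex.ofReal_im, zero_mul, sub_zero, add_zero]
  linear_combination (-(2 * π) ^ 2) * (a 0 * (v 0).re + a 1 * (v 1).re + a 2 * (v 2).re) * hr
    - (2 * π) ^ 2 * (a 0 * (v 0).im + a 1 * (v 1).im + a 2 * (v 2).im) * hi

/-- strain of the third component -/
lemma strain3 (z : Fin 3 → ℂ) (a : E3)
    (h : (a 0 : ℂ) * z 0 + (a 1 : ℂ) * z 1 + (a 2 : ℂ) * z 2 = 0) :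
    ‖(π * Complex.I) * ((a 0 : ℂ) * z 2 + (a 2 : ℂ) * z 0)‖ ^ 2
     + ‖(π * Complex.I) * ((a 1 : ℂ) * z 2 + (a 2 : ℂ) * z 1)‖ ^ 2 ≤
     (1 / 4) * (‖Om z a 0‖ ^ 2 + ‖Om z a 1‖ ^ 2) := by
  have hr := congrArg Complex.re h
  have hi := congrArg Complex.im h
  simp at hr hi
  simp only [Om, Matrix.cons_val_zero, Matrix.cons_val_one, Matrix.cons_val,
    nsq_2piI, nsq_piI]
  simp only [Complex.sub_re, Complex.sub_im, Complex.mul_re, Complex.mul_im, Complex.ofReal_re,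
    Complex.ofReal_im, zero_mul, sub_zero, add_zero, Complex.add_re, Complex.add_im]
  have : 0 ≤ 4 * π ^ 2 * (a 2) ^ 2 * ((z 2).re ^ 2 + (z 2).im ^ 2) := by positivity
  linear_combination this + 4 * π ^ 2 * a 2 * (z 2).re * hr + 4 * π ^ 2 * a 2 * (z 2).im * hi

lemma stretch_bd (a : E3) (v : Fin 3 → ℂ) (o0 o1 p0 p1 : ℂ)
    (h : (a 0 : ℂ) * v 0 + (a 1 : ℂ) * v 1 + (a 2 : ℂ) * v 2 = 0) :
    inner ℝ o0 ((π * Complex.I) * ((a 0 : ℂ) * v 0 + (a 0 : ℂ) * v 0) * p0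
        + (π * Complex.I) * ((a 0 : ℂ) * v 1 + (a 1 : ℂ) * v 0) * p1)
      + inner ℝ o1 ((π * Complex.I) * ((a 1 : ℂ) * v 0 + (a 0 : ℂ) * v 1) * p0
        + (π * Complex.I) * ((a 1 : ℂ) * v 1 + (a 1 : ℂ) * v 1) * p1)
    ≤ (1 / 2) * (2 * π * ‖a‖ * ‖vE v‖) * √(‖o0‖ ^ 2 + ‖o1‖ ^ 2) * √(‖p0‖ ^ 2 + ‖p1‖ ^ 2) := by
  set e := vE (fun i => (a i : ℂ)) with he
  set o := vE ![o0, o1, 0] with ho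
  set p := vE ![star p0, star p1, 0] with hp
  have h0 : inner ℂ e (vE v) = 0 := by
    rw [he, vE_inner, ← h]; simp
  have hb := bilin_bd e (vE v) o p h0
  have no : ‖o‖ = √(‖o0‖ ^ 2 + ‖o1‖ ^ 2) := by
    rw [← Real.sqrt_sq (norm_nonneg o), ho, vE_norm]; simp
  have np : ‖p‖ = √(‖p0‖ ^ 2 + ‖p1‖ ^ 2) := by
    rw [← Real.sqrt_sq (norm_nonneg p), hp, vE_norm]; simp
  have key : inner ℝ o0 ((π * Complex.I) * ((a 0 : ℂ) * v 0 + (a 0 : ℂ) * v 0) * p0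
        + (π * Complex.I) * ((a 0 : ℂ) * v 1 + (a 1 : ℂ) * v 0) * p1)
      + inner ℝ o1 ((π * Complex.I) * ((a 1 : ℂ) * v 0 + (a 0 : ℂ) * v 1) * p0
        + (π * Complex.I) * ((a 1 : ℂ) * v 1 + (a 1 : ℂ) * v 1) * p1)
      = ((π * Complex.I) * (inner ℂ o e * inner ℂ p (vE v) + inner ℂ o (vE v) * inner ℂ p e)).re := by
    rw [Complex.inner, Complex.inner, ← Complex.add_re]
    congr 1
    rw [he, ho, hp, vE_inner, vE_inner, vE_inner, vE_inner]
    simp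
    ring
  rw [key]
  refine (Complex.re_le_norm _).trans ?_
  rw [norm_mul, norm_piI, ← no, ← np]
  have h1 : ‖inner ℂ o e * inner ℂ p (vE v) + inner ℂ o (vE v) * inner ℂ p e‖ ≤ ‖e‖ * ‖vE v‖ * ‖o‖ * ‖p‖ := by
    refine (norm_add_le _ _).trans ?_
    rw [norm_mul, norm_mul, norm_inner_symm o e, norm_inner_symm p, norm_inner_symm o, norm_inner_symm p e]
    exact hb
  rw [he, vE_real] at h1
  have := mul_le_mul_of_nonneg_left h1 pi_pos.le
  linarith

lemma dot_bd (v : Fin 3 → ℂ) (b : E3) :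
    ‖v 0 * (b 0 : ℂ) + v 1 * (b 1 : ℂ) + v 2 * (b 2 : ℂ)‖ ≤ ‖vE v‖ * ‖b‖ := by
  have h := norm_inner_le_norm (𝕜 := ℂ) (vE (fun i => (b i : ℂ))) (vE v)
  rw [vE_inner, vE_real] at h
  simp only [Complex.star_def, Complex.conj_ofReal] at h
  rw [mul_comm (v 0), mul_comm (v 1), mul_comm (v 2)]
  linarith
end part_4

section part_5
/-- divergence-free on the Fourier side -/
def DivF (u : Fin 3 → 𝓢(E3, ℝ)) : Prop :=
  ∀ ξ : E3, (ξ 0 : ℂ) * FS (u 0) ξ + (ξ 1 : ℂ) * FS (u 1) ξ + (ξ 2 : ℂ) * FS (u 2) ξ = 0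

lemma sol_DivF {ν : ℝ} {T : ℝ≥0∞} (sol : AdmissibleSolution ν T) {t : ℝ} (ht : t ∈ timeSet T) :
    DivF (sol.u t) := by
  intro ξ
  have h : DS 0 (sol.u t 0) + DS 1 (sol.u t 1) + DS 2 (sol.u t 2) = 0 := by
    ext x
    have := sol.divfree t ht x
    rw [Fin.sum_univ_three] at this
    simpa [DS_coe] using this
  have h2 : FS (DS 0 (sol.u t 0) + DS 1 (sol.u t 1) + DS 2 (sol.u t 2)) ξ = 0 := by
    rw [h]
    have := FS_smul (0 : ℝ) (0 : 𝓢(E3, ℝ))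
    rw [zero_smul] at this
    rw [this]; simp
  rw [FS_add, FS_add, add_apply, add_apply, FS_DS, FS_DS, FS_DS] at h2
  have h3 : (2 * π * Complex.I) * ((ξ 0 : ℂ) * FS (sol.u t 0) ξ + (ξ 1 : ℂ) * FS (sol.u t 1) ξ
    + (ξ 2 : ℂ) * FS (sol.u t 2) ξ) = 0 := by rw [← h2]; ring
  rcases mul_eq_zero.mp h3 with h4 | h4
  · exact absurd h4 Complex.two_pi_I_ne_zero
  · exact h4

variable (u : Fin 3 → 𝓢(E3, ℝ))

/-- squared modulus of full vorticity -/
def F2 (a : E3) : ℝ :=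
  ‖FS (curlS u 0) a‖ ^ 2 + ‖FS (curlS u 1) a‖ ^ 2 + ‖FS (curlS u 2) a‖ ^ 2

/-- transport kernel without weight -/
def Q1 (ξ η : E3) : ℝ :=
  inner ℝ (FS (curlS u 0) ξ) (-(FS (u 0) (ξ - η) * FS (DS 0 (curlS u 0)) η
    + FS (u 1) (ξ - η) * FS (DS 1 (curlS u 0)) η + FS (u 2) (ξ - η) * FS (DS 2 (curlS u 0)) η))
  + inner ℝ (FS (curlS u 1) ξ) (-(FS (u 0) (ξ - η) * FS (DS 0 (curlS u 1)) η
    + FS (u 1) (ξ - η) * FS (DS 1 (curlS u 1)) η + FS (u 2) (ξ - η) * FS (DS 2 (curlS u 1)) η))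

/-- stretching kernel without weight -/
def Q2 (ξ η : E3) : ℝ :=
  inner ℝ (FS (curlS u 0) ξ) (FS (strainS u 0 0) (ξ - η) * FS (curlS u 0) η
    + FS (strainS u 0 1) (ξ - η) * FS (curlS u 1) η + FS (curlS u 2) (ξ - η) * FS (strainS u 0 2) η)
  + inner ℝ (FS (curlS u 1) ξ) (FS (strainS u 1 0) (ξ - η) * FS (curlS u 0) η
    + FS (strainS u 1 1) (ξ - η) * FS (curlS u 1) η + FS (curlS u 2) (ξ - η) * FS (strainS u 1 2) η)

variable {u}

lemma F_eq (hd : DivF u) (a : E3) : √(F2 u a) = 2 * π * ‖a‖ * ‖vE (fun i => FS (u i) a)‖ := by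
  rw [F2, FS_curl, FS_curl, FS_curl, Om_sq _ a (hd a), Real.sqrt_sq (by positivity)]

lemma Q2_bd (hd : DivF u) (ξ η : E3) :
    Q2 u ξ η ≤ √(F2 u (ξ - η)) * √(W2 u ξ) * √(W2 u η) := by
  have h1 := stretch_bd (ξ - η) (fun i => FS (u i) (ξ - η)) (FS (curlS u 0) ξ) (FS (curlS u 1) ξ)
    (FS (curlS u 0) η) (FS (curlS u 1) η) (hd _)
  rw [← F_eq hd] at h1
  simp only [← FS_strain] at h1
  have h2 := strain3 (fun i => FS (u i) η) η (hd η)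
  simp only [← FS_strain, ← FS_curl] at h2
  have h3 : inner ℝ (FS (curlS u 0) ξ) (FS (curlS u 2) (ξ - η) * FS (strainS u 0 2) η)
      + inner ℝ (FS (curlS u 1) ξ) (FS (curlS u 2) (ξ - η) * FS (strainS u 1 2) η)
      ≤ (1 / 2) * √(F2 u (ξ - η)) * √(W2 u ξ) * √(W2 u η) := by
    have e0 := real_inner_le_norm (FS (curlS u 0) ξ) (FS (curlS u 2) (ξ - η) * FS (strainS u 0 2) η)
    have e1 := real_inner_le_norm (FS (curlS u 1) ξ) (FS (curlS u 2) (ξ - η) * FS (strainS u 1 2) η)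
    rw [norm_mul] at e0 e1
    have e2 := cs2 ‖FS (curlS u 0) ξ‖ ‖FS (strainS u 0 2) η‖ ‖FS (curlS u 1) ξ‖ ‖FS (strainS u 1 2) η‖
    have e3 : √(‖FS (strainS u 0 2) η‖ ^ 2 + ‖FS (strainS u 1 2) η‖ ^ 2) ≤ (1 / 2) * √(W2 u η) := by
      refine Real.sqrt_le_iff.mpr ⟨by positivity, ?_⟩
      rw [mul_pow, Real.sq_sqrt (by unfold W2; positivity)]
      unfold W2
      linarith
    have e4 : ‖FS (curlS u 2) (ξ - η)‖ ≤ √(F2 u (ξ - η)) := by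
      apply Real.le_sqrt_of_sq_le
      unfold F2
      linarith [sq_nonneg ‖FS (curlS u 0) (ξ - η)‖, sq_nonneg ‖FS (curlS u 1) (ξ - η)‖]
    calc _ ≤ ‖FS (curlS u 2) (ξ - η)‖ * (‖FS (curlS u 0) ξ‖ * ‖FS (strainS u 0 2) η‖
            + ‖FS (curlS u 1) ξ‖ * ‖FS (strainS u 1 2) η‖) := by linarith
      _ ≤ √(F2 u (ξ - η)) * (√(W2 u ξ) * ((1 / 2) * √(W2 u η))) := by
          refine mul_le_mul e4 (e2.trans ?_) (by positivity) (by positivity)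
          unfold W2 at *
          gcongr
      _ = _ := by ring
  unfold Q2
  simp only [inner_add_right] at *
  unfold W2 at *
  linarith

/-- dot product -/
def dotV (u : Fin 3 → 𝓢(E3, ℝ)) (ξ η : E3) : ℂ :=
  FS (u 0) (ξ - η) * (η 0 : ℂ) + FS (u 1) (ξ - η) * (η 1 : ℂ) + FS (u 2) (ξ - η) * (η 2 : ℂ)

lemma Q1_eq (ξ η : E3) : Q1 u ξ η =
    (-(2 * π * Complex.I) * dotV u ξ η * (star (FS (curlS u 0) ξ) * FS (curlS u 0) η
      + star (FS (curlS u 1) ξ) * FS (curlS u 1) η)).re := by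
  unfold Q1
  rw [Complex.inner, Complex.inner, ← Complex.add_re]
  congr 1
  simp only [FS_DS, dotV, Complex.star_def]
  ring

lemma Q1_bd (ξ η : E3) : |Q1 u ξ η| ≤
    2 * π * (‖vE (fun i => FS (u i) (ξ - η))‖ * ‖η‖) * (√(W2 u ξ) * √(W2 u η)) := by
  rw [Q1_eq]
  refine (Complex.abs_re_le_norm _).trans ?_
  rw [norm_mul, norm_mul, norm_neg, norm_2piI]
  have h1 : ‖dotV u ξ η‖ ≤ _ := dot_bd (fun i => FS (u i) (ξ - η)) η
  have h2 : ‖star (FS (curlS u 0) ξ) * FS (curlS u 0) η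
      + star (FS (curlS u 1) ξ) * FS (curlS u 1) η‖ ≤ √(W2 u ξ) * √(W2 u η) := by
    refine (norm_add_le _ _).trans ?_
    rw [norm_mul, norm_mul, norm_star, norm_star]
    exact cs2 _ _ _ _
  gcongr

lemma dotV_symm (hd : DivF u) (ξ η : E3) : dotV u η ξ = star (dotV u ξ η) := by
  have h := hd (ξ - η)
  have h1 : ∀ i, FS (u i) (η - ξ) = star (FS (u i) (ξ - η)) := by
    intro i; rw [← neg_sub ξ η, FS_conj]; rfl
  have h2 : dotV u ξ η = FS (u 0) (ξ - η) * (ξ 0 : ℂ) + FS (u 1) (ξ - η) * (ξ 1 : ℂ)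
      + FS (u 2) (ξ - η) * (ξ 2 : ℂ) := by
    unfold dotV
    simp only [PiLp.sub_apply, Complex.ofReal_sub] at h
    linear_combination -h
  rw [h2]
  unfold dotV
  rw [h1, h1, h1]
  simp

lemma Q1_symm (hd : DivF u) (ξ η : E3) : Q1 u η ξ = - Q1 u ξ η := by
  rw [Q1_eq, Q1_eq, dotV_symm hd ξ η, ← Complex.neg_re, ← Complex.conj_re]
  congr 1
  have h2 : (starRingEnd ℂ) 2 = 2 := Complex.conj_ofNat 2
  simp only [Complex.star_def, map_mul, map_add, map_neg, Complex.conj_conj, h2, Complex.conj_I,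
    Complex.conj_ofReal]
  ring

lemma W2_zero : W2 u 0 = 0 := by
  simp [W2, FS_curl, Om]

lemma T1_bd (hd : DivF u) (ξ η : E3) :
    (2 * π * ‖ξ‖)⁻¹ * Q1 u ξ η + (2 * π * ‖η‖)⁻¹ * Q1 u η ξ ≤
      (2 * π * ‖ξ‖)⁻¹ * (√(F2 u (ξ - η)) * √(W2 u ξ) * √(W2 u η)) := by
  rw [Q1_symm hd ξ η]
  have hb := Q1_bd (u := u) ξ η
  by_cases hξ : ξ = 0
  · have : Q1 u ξ η = 0 := by
      rw [← abs_nonpos_iff]; refine hb.trans ?_; rw [hξ, W2_zero]; simp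
    rw [this]; simp; positivity
  by_cases hη : η = 0
  · have : Q1 u ξ η = 0 := by
      rw [← abs_nonpos_iff]; refine hb.trans ?_; rw [hη, W2_zero]; simp
    rw [this]; simp; positivity
  have hξ' : 0 < ‖ξ‖ := norm_pos_iff.mpr hξ
  have hη' : 0 < ‖η‖ := norm_pos_iff.mpr hη
  have e : (2 * π * ‖ξ‖)⁻¹ * Q1 u ξ η + (2 * π * ‖η‖)⁻¹ * -Q1 u ξ η
      = Q1 u ξ η * ((‖η‖ - ‖ξ‖) / (2 * π * ‖ξ‖ * ‖η‖)) := by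
    field_simp
    ring
  rw [e, F_eq hd]
  refine (le_abs_self _).trans ?_
  rw [abs_mul, abs_div, abs_of_pos (by positivity : 0 < 2 * π * ‖ξ‖ * ‖η‖)]
  have h3 : |‖η‖ - ‖ξ‖| ≤ ‖ξ - η‖ := by
    rw [abs_sub_comm]; exact abs_norm_sub_norm_le ξ η
  calc _ ≤ (2 * π * (‖vE (fun i => FS (u i) (ξ - η))‖ * ‖η‖) * (√(W2 u ξ) * √(W2 u η))) *
        (‖ξ - η‖ / (2 * π * ‖ξ‖ * ‖η‖)) := by gcongr
    _ = _ := by field_simp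
end part_5

section part_6
variable (u : Fin 3 → 𝓢(E3, ℝ))

/-- weighted pairing kernel -/
def WK (k : Fin 3) (N : E3 × E3 → ℂ) (p : E3 × E3) : ℝ :=
  (2 * π * ‖p.1‖)⁻¹ * inner ℝ (FS (curlS u k) p.1) (N p)

/-- a Schwartz function whose pairing with the vorticity is given by a kernel -/
def Good (k : Fin 3) (h : 𝓢(E3, ℝ)) (N : E3 × E3 → ℂ) : Prop :=
  Integrable (WK u k N) (volume.prod volume) ∧
  ∫ ξ, (2 * π * ‖ξ‖)⁻¹ * inner ℝ (FS (curlS u k) ξ) (FS h ξ) = ∫ p, WK u k N p ∂(volume.prod volume)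

variable {u}

lemma Good.add {k : Fin 3} {h h' : 𝓢(E3, ℝ)} {N N' : E3 × E3 → ℂ} (H : Good u k h N)
    (H' : Good u k h' N') : Good u k (h + h') (fun p => N p + N' p) := by
  have e : WK u k (fun p => N p + N' p) = fun p => WK u k N p + WK u k N' p := by
    ext p; simp only [WK, inner_add_right]; ring
  refine ⟨by rw [e]; exact H.1.add H'.1, ?_⟩
  rw [e, integral_add H.1 H'.1, ← H.2, ← H'.2,
    ← integral_add (weighted_integrable u k _) (weighted_integrable u k _)]
  congr 1; ext ξ
  rw [FS_add, add_apply, inner_add_right]; ring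

lemma Good.neg {k : Fin 3} {h : 𝓢(E3, ℝ)} {N : E3 × E3 → ℂ} (H : Good u k h N) :
    Good u k (-h) (fun p => -N p) := by
  have e : WK u k (fun p => -N p) = fun p => -WK u k N p := by
    ext p; simp only [WK, inner_neg_right]; ring
  refine ⟨by rw [e]; exact H.1.neg, ?_⟩
  rw [e, integral_neg, ← H.2, ← integral_neg]
  congr 1; ext ξ
  have : FS (-h) = - FS h := by
    have := FS_smul (-1 : ℝ) h
    simpa using this
  rw [this, neg_apply, inner_neg_right]; ring

lemma good_mS (k : Fin 3) (f g : 𝓢(E3, ℝ)) :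
    Good u k (mS f g) (fun p => FS f (p.1 - p.2) * FS g p.2) := by
  have hf : ∀ ξ, ‖FS f ξ‖ ≤ SchwartzMap.seminorm ℝ 0 0 (FS f) :=
    fun ξ => SchwartzMap.norm_le_seminorm ℝ (FS f) ξ
  have hint : Integrable (WK u k (fun p => FS f (p.1 - p.2) * FS g p.2)) (volume.prod volume) := by
    have hb : Integrable (fun p : E3 × E3 => (SchwartzMap.seminorm ℝ 0 0 (FS f) *
        ∑ i, ‖FS (u i) p.1‖) * ‖FS g p.2‖) (volume.prod volume) :=
      Integrable.mul_prod ((integrable_finsetSum _ fun i _ => (FS (u i)).integrable.norm).const_mul _)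
        (FS g).integrable.norm
    refine hb.mono' ?_ (Filter.Eventually.of_forall fun p => ?_)
    · refine AEStronglyMeasurable.mul (by fun_prop) ?_
      refine (Continuous.inner (𝕜 := ℝ) ((FS (curlS u k)).continuous.comp continuous_fst) ?_).aestronglyMeasurable
      exact ((FS f).continuous.comp (continuous_fst.sub continuous_snd)).mul
        ((FS g).continuous.comp continuous_snd)
    · unfold WK
      rw [norm_mul, Real.norm_of_nonneg (by positivity), Real.norm_eq_abs]
      have h1 := inner_abs_le (FS (curlS u k) p.1) (FS f (p.1 - p.2) * FS g p.2)
      have h2 := Om_div_norm (fun i => FS (u i) p.1) p.1 k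
      rw [← FS_curl] at h2
      rw [norm_mul] at h1
      have h3 := hf (p.1 - p.2)
      calc _ ≤ (2 * π * ‖p.1‖)⁻¹ * (‖FS (curlS u k) p.1‖ * (‖FS f (p.1 - p.2)‖ * ‖FS g p.2‖)) := by gcongr
        _ = (‖FS f (p.1 - p.2)‖ * ((2 * π * ‖p.1‖)⁻¹ * ‖FS (curlS u k) p.1‖)) * ‖FS g p.2‖ := by ring
        _ ≤ _ := by gcongr
  refine ⟨hint, ?_⟩
  rw [integral_prod _ hint]
  congr 1; ext ξ
  simp only [WK]
  rw [integral_const_mul, FS_mS, integral_inner]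
  refine ((FS g).integrable.norm.const_mul (SchwartzMap.seminorm ℝ 0 0 (FS f))).mono' ?_
    (Filter.Eventually.of_forall fun η => ?_)
  · exact (((FS f).continuous.comp (continuous_const.sub continuous_id)).mul
        (FS g).continuous).aestronglyMeasurable
  · rw [norm_mul]
    have := hf (ξ - η)
    gcongr

/-- transport part -/
def NT (u : Fin 3 → 𝓢(E3, ℝ)) (k : Fin 3) : 𝓢(E3, ℝ) :=
  -(mS (u 0) (DS 0 (curlS u k)) + mS (u 1) (DS 1 (curlS u k)) + mS (u 2) (DS 2 (curlS u k)))

/-- stretching part -/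
def NST (u : Fin 3 → 𝓢(E3, ℝ)) (k : Fin 3) : 𝓢(E3, ℝ) :=
  mS (strainS u k 0) (curlS u 0) + mS (strainS u k 1) (curlS u 1)
    + mS (curlS u 2) (strainS u k 2)

lemma good_NT (k : Fin 3) : Good u k (NT u k) (fun p => -(FS (u 0) (p.1 - p.2) * FS (DS 0 (curlS u k)) p.2
    + FS (u 1) (p.1 - p.2) * FS (DS 1 (curlS u k)) p.2 + FS (u 2) (p.1 - p.2) * FS (DS 2 (curlS u k)) p.2)) :=
  (((good_mS k _ _).add (good_mS k _ _)).add (good_mS k _ _)).neg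

lemma good_NST (k : Fin 3) : Good u k (NST u k) (fun p => FS (strainS u k 0) (p.1 - p.2) * FS (curlS u 0) p.2
    + FS (strainS u k 1) (p.1 - p.2) * FS (curlS u 1) p.2 + FS (curlS u 2) (p.1 - p.2) * FS (strainS u k 2) p.2) :=
  ((good_mS k _ _).add (good_mS k _ _)).add (good_mS k _ _)

lemma int_Q1 : Integrable (fun p : E3 × E3 => (2 * π * ‖p.1‖)⁻¹ * Q1 u p.1 p.2) (volume.prod volume) := by
  refine ((good_NT (u := u) 0).1.add (good_NT (u := u) 1).1).congr (Filter.Eventually.of_forall fun p => ?_)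
  simp only [WK, Q1, Pi.add_apply]; ring

lemma int_Q2 : Integrable (fun p : E3 × E3 => (2 * π * ‖p.1‖)⁻¹ * Q2 u p.1 p.2) (volume.prod volume) := by
  refine ((good_NST (u := u) 0).1.add (good_NST (u := u) 1).1).congr (Filter.Eventually.of_forall fun p => ?_)
  simp only [WK, Q2, Pi.add_apply]; ring

/-- the weighted pairing -/
def PR (u : Fin 3 → 𝓢(E3, ℝ)) (k : Fin 3) (h : 𝓢(E3, ℝ)) : ℝ :=
  ∫ ξ, (2 * π * ‖ξ‖)⁻¹ * inner ℝ (FS (curlS u k) ξ) (FS h ξ)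

lemma PR_add (k : Fin 3) (h h' : 𝓢(E3, ℝ)) : PR u k (h + h') = PR u k h + PR u k h' := by
  unfold PR
  rw [← integral_add (weighted_integrable u k _) (weighted_integrable u k _)]
  congr 1; ext ξ
  rw [FS_add, add_apply, inner_add_right]; ring

lemma PR_NT : PR u 0 (NT u 0) + PR u 1 (NT u 1) =
    ∫ p : E3 × E3, (2 * π * ‖p.1‖)⁻¹ * Q1 u p.1 p.2 ∂(volume.prod volume) := by
  unfold PR
  rw [(good_NT (u := u) 0).2, (good_NT (u := u) 1).2, ← integral_add (good_NT (u := u) 0).1 (good_NT (u := u) 1).1]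
  congr 1; ext p
  simp only [WK, Q1]; ring

lemma PR_NST : PR u 0 (NST u 0) + PR u 1 (NST u 1) =
    ∫ p : E3 × E3, (2 * π * ‖p.1‖)⁻¹ * Q2 u p.1 p.2 ∂(volume.prod volume) := by
  unfold PR
  rw [(good_NST (u := u) 0).2, (good_NST (u := u) 1).2, ← integral_add (good_NST (u := u) 0).1 (good_NST (u := u) 1).1]
  congr 1; ext p
  simp only [WK, Q2]; ring

/-- Laplacian -/
def LapS (u : Fin 3 → 𝓢(E3, ℝ)) (k : Fin 3) : 𝓢(E3, ℝ) :=
  DS 0 (DS 0 (curlS u k)) + DS 1 (DS 1 (curlS u k)) + DS 2 (DS 2 (curlS u k))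

lemma FS_Lap (k : Fin 3) (ξ : E3) :
    FS (LapS u k) ξ = ((-(2 * π * ‖ξ‖) ^ 2 : ℝ) : ℂ) * FS (curlS u k) ξ := by
  have h : ‖ξ‖ ^ 2 = ξ 0 ^ 2 + ξ 1 ^ 2 + ξ 2 ^ 2 := by
    rw [EuclideanSpace.norm_sq_eq, Fin.sum_univ_three]; simp
  rw [mul_pow, h]
  simp only [LapS, FS_add, add_apply, FS_DS]
  push_cast
  linear_combination (2 * π) ^ 2 * ((ξ 0 : ℂ) ^ 2 + (ξ 1 : ℂ) ^ 2 + (ξ 2 : ℂ) ^ 2) * FS (curlS u k) ξ * Complex.I_sq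

lemma W2_integrable' : Integrable (fun ξ => (2 * π * ‖ξ‖) * W2 u ξ) := by
  have h0 := weighted_integrable u 0 (FS (LapS u 0))
  have h1 := weighted_integrable u 1 (FS (LapS u 1))
  refine (h0.add h1).neg.congr (Filter.Eventually.of_forall fun ξ => ?_)
  simp only [Pi.add_apply, Pi.neg_apply, FS_Lap, W2]
  rw [← smul_eq_mul ((_ : ℝ) : ℂ), ← smul_eq_mul ((_ : ℝ) : ℂ), Complex.coe_smul, Complex.coe_smul,
    inner_smul_right, inner_smul_right, real_inner_self_eq_norm_sq, real_inner_self_eq_norm_sq]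
  by_cases h : ‖ξ‖ = 0
  · simp [h]
  · have : 0 < ‖ξ‖ := lt_of_le_of_ne (norm_nonneg _) (Ne.symm h)
    field_simp
    ring

lemma PR_Lap (ν : ℝ) : PR u 0 (ν • LapS u 0) + PR u 1 (ν • LapS u 1) = - ν * ∫ ξ, (2 * π * ‖ξ‖) * W2 u ξ := by
  unfold PR
  rw [← integral_add (weighted_integrable u 0 _) (weighted_integrable u 1 _), ← integral_const_mul]
  congr 1; ext ξ
  simp only [FS_smul, smul_apply, FS_Lap, W2]
  rw [← smul_eq_mul ((_ : ℝ) : ℂ), ← smul_eq_mul ((_ : ℝ) : ℂ), Complex.coe_smul, Complex.coe_smul,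
    inner_smul_right, inner_smul_right, inner_smul_right, inner_smul_right,
    real_inner_self_eq_norm_sq, real_inner_self_eq_norm_sq]
  by_cases h : ‖ξ‖ = 0
  · simp [h]
  · have : 0 < ‖ξ‖ := lt_of_le_of_ne (norm_nonneg _) (Ne.symm h)
    field_simp
    ring

lemma NLS_eq (ν : ℝ) (k : Fin 3) : NLS ν u k = ν • LapS u k + NT u k + NST u k := by
  unfold NLS LapS NT NST; abel
end part_6

section part_7
lemma lint_ball (R : ℝ) (hR : 0 ≤ R) :
    ∫⁻ ξ : E3 in Metric.ball 0 R, ENNReal.ofReal ((‖ξ‖ ^ 2)⁻¹) ≤ ENNReal.ofReal (4 * π * R) := by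
  have hI : IntegrableOn (fun ξ : E3 => (‖ξ‖ ^ 2)⁻¹) (Metric.ball 0 R) := by
    rw [integrableOn_fun_norm_addHaar volume (f := fun y => (y ^ 2)⁻¹)]
    refine (integrableOn_const (C := (1 : ℝ)) (s := Set.Ioo 0 R) (by simp)).congr_fun ?_ measurableSet_Ioo
    intro y hy
    have : y ≠ 0 := hy.1.ne'
    simp [this]
  rw [← ofReal_integral_eq_lintegral_ofReal hI (Filter.Eventually.of_forall fun ξ => by positivity)]
  apply ENNReal.ofReal_le_ofReal
  have e : ∫ ξ : E3 in Metric.ball 0 R, (‖ξ‖ ^ 2)⁻¹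
      = ∫ ξ : E3, (Set.Iio R).indicator (fun y : ℝ => (y ^ 2)⁻¹) ‖ξ‖ := by
    rw [← integral_indicator measurableSet_ball]
    congr 1; ext ξ
    simp [Set.indicator]
  rw [e, integral_fun_norm_addHaar]
  have e2 : ∫ y in Set.Ioi (0 : ℝ), y ^ (Module.finrank ℝ E3 - 1) • (Set.Iio R).indicator (fun y : ℝ => (y ^ 2)⁻¹) y
      = ∫ y in Set.Ioi (0 : ℝ), (Set.Iio R).indicator (fun _ => (1 : ℝ)) y := by
    refine setIntegral_congr_fun measurableSet_Ioi fun y hy => ?_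
    have : y ≠ 0 := (Set.mem_Ioi.mp hy).ne'
    by_cases h : y < R <;> simp [h, this]
  rw [e2, setIntegral_indicator measurableSet_Iio, Set.Ioi_inter_Iio]
  have e3 : volume.real (Metric.ball (0 : E3) 1) = π * 4 / 3 := by
    simp [Measure.real, EuclideanSpace.volume_ball_fin_three, pi_pos.le]
    positivity
  rw [e3]
  simp [hR]
  linarith

lemma integral_le_of_lintegral {α : Type*} [MeasurableSpace α] {μ : Measure α} {f : α → ℝ} {C : ℝ}
    (hC : 0 ≤ C) (h : ∫⁻ x, ENNReal.ofReal (f x) ∂μ ≤ ENNReal.ofReal C) : ∫ x, f x ∂μ ≤ C := by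
  by_cases hf : Integrable f μ
  · rw [integral_eq_lintegral_pos_part_sub_lintegral_neg_part hf]
    have := ENNReal.toReal_mono ENNReal.ofReal_ne_top h
    rw [ENNReal.toReal_ofReal hC] at this
    linarith [ENNReal.toReal_nonneg (a := ∫⁻ x, ENNReal.ofReal (-f x) ∂μ)]
  · rw [integral_undef hf]; exact hC

section abstract_bound
variable {F W : E3 → ℝ}

lemma ofReal_mul4 (hF : Continuous F) (hW : Continuous W) (hF0 : ∀ x, 0 ≤ F x) (hW0 : ∀ x, 0 ≤ W x)
    (iF : Integrable F) (iW : Integrable W) :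
    ∫⁻ p : E3 × E3, ENNReal.ofReal (F (p.1 - p.2)) * ENNReal.ofReal (W p.2) ∂(volume.prod volume)
      = ENNReal.ofReal ((∫ x, F x) * ∫ x, W x) := by
  rw [lintegral_prod_symm' _ (by fun_prop)]
  have : ∀ η : E3, ∫⁻ ξ : E3, ENNReal.ofReal (F (ξ - η)) * ENNReal.ofReal (W η)
      = ENNReal.ofReal (∫ x, F x) * ENNReal.ofReal (W η) := by
    intro η
    rw [lintegral_mul_const _ (by fun_prop), lintegral_sub_right_eq_self (fun ξ => ENNReal.ofReal (F ξ)),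
      ofReal_integral_eq_lintegral_ofReal iF (Filter.Eventually.of_forall hF0)]
  simp only [this]
  rw [lintegral_const_mul _ (by fun_prop), ENNReal.ofReal_mul (integral_nonneg hF0),
    ofReal_integral_eq_lintegral_ofReal iW (Filter.Eventually.of_forall hW0)]

lemma ofReal_mul5 (hF : Continuous F) (hW : Continuous W) (hF0 : ∀ x, 0 ≤ F x) (hW0 : ∀ x, 0 ≤ W x)
    (iF : Integrable F) (iW : Integrable W) :
    ∫⁻ p : E3 × E3, ENNReal.ofReal (F (p.1 - p.2)) * ENNReal.ofReal (W p.1) ∂(volume.prod volume)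
      = ENNReal.ofReal ((∫ x, F x) * ∫ x, W x) := by
  rw [lintegral_prod _ (by fun_prop)]
  have : ∀ ξ : E3, ∫⁻ η : E3, ENNReal.ofReal (F (ξ - η)) * ENNReal.ofReal (W ξ)
      = ENNReal.ofReal (∫ x, F x) * ENNReal.ofReal (W ξ) := by
    intro η
    rw [lintegral_mul_const _ (by fun_prop), lintegral_sub_left_eq_self (fun ξ => ENNReal.ofReal (F ξ)),
      ofReal_integral_eq_lintegral_ofReal iF (Filter.Eventually.of_forall hF0)]
  simp only [this]
  rw [lintegral_const_mul _ (by fun_prop), ENNReal.ofReal_mul (integral_nonneg hF0),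
    ofReal_integral_eq_lintegral_ofReal iW (Filter.Eventually.of_forall hW0)]

lemma lint_I3 (hW : Continuous W) (hW0 : ∀ x, 0 ≤ W x) (iW : Integrable (fun x => ‖x‖ * W x)) :
    ∫⁻ p : E3 × E3, Set.indicator {p : E3 × E3 | ‖p.2‖ ≤ ‖p.1‖}
      (fun p => ENNReal.ofReal (W p.1 * (‖p.1‖ ^ 2)⁻¹)) p ∂(volume.prod volume)
      ≤ ENNReal.ofReal (4 * π / 3 * ∫ x, ‖x‖ * W x) := by
  have hm : MeasurableSet {p : E3 × E3 | ‖p.2‖ ≤ ‖p.1‖} := measurableSet_le (by fun_prop) (by fun_prop)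
  rw [lintegral_prod _ (Measurable.aemeasurable (Measurable.indicator (by fun_prop) hm))]
  have : ∀ ξ : E3, ∫⁻ η : E3, Set.indicator {p : E3 × E3 | ‖p.2‖ ≤ ‖p.1‖}
      (fun p => ENNReal.ofReal (W p.1 * (‖p.1‖ ^ 2)⁻¹)) (ξ, η) ≤
      ENNReal.ofReal (4 * π / 3 * (‖ξ‖ * W ξ)) := by
    intro ξ
    have e : ∀ η : E3, Set.indicator {p : E3 × E3 | ‖p.2‖ ≤ ‖p.1‖}
      (fun p => ENNReal.ofReal (W p.1 * (‖p.1‖ ^ 2)⁻¹)) (ξ, η) =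
      Set.indicator (Metric.closedBall 0 ‖ξ‖) (fun _ => ENNReal.ofReal (W ξ * (‖ξ‖ ^ 2)⁻¹)) η := by
      intro η; simp [Set.indicator]
    simp only [e]
    rw [lintegral_indicator measurableSet_closedBall, setLIntegral_const,
      EuclideanSpace.volume_closedBall_fin_three, ← ENNReal.ofReal_pow (norm_nonneg _),
      ← ENNReal.ofReal_mul (by positivity), ← ENNReal.ofReal_mul (mul_nonneg (hW0 _) (by positivity))]
    apply ENNReal.ofReal_le_ofReal
    by_cases h : ‖ξ‖ = 0
    · simp [h]
    · apply le_of_eq; field_simp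
  refine (lintegral_mono this).trans (le_of_eq ?_)
  rw [← ofReal_integral_eq_lintegral_ofReal (iW.const_mul _)
    (Filter.Eventually.of_forall fun x => mul_nonneg (by positivity) (mul_nonneg (norm_nonneg _) (hW0 x))),
    integral_const_mul]

lemma lint_I4 (hW : Continuous W) (hW0 : ∀ x, 0 ≤ W x) (iW : Integrable (fun x => ‖x‖ * W x)) :
    ∫⁻ p : E3 × E3, Set.indicator {p : E3 × E3 | ‖p.1‖ < ‖p.2‖}
      (fun p => ENNReal.ofReal (W p.2 * (‖p.1‖ ^ 2)⁻¹)) p ∂(volume.prod volume)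
      ≤ ENNReal.ofReal (4 * π * ∫ x, ‖x‖ * W x) := by
  have hm : MeasurableSet {p : E3 × E3 | ‖p.1‖ < ‖p.2‖} := measurableSet_lt (by fun_prop) (by fun_prop)
  rw [lintegral_prod_symm' _ (Measurable.indicator (by fun_prop) hm)]
  have : ∀ η : E3, ∫⁻ ξ : E3, Set.indicator {p : E3 × E3 | ‖p.1‖ < ‖p.2‖}
      (fun p => ENNReal.ofReal (W p.2 * (‖p.1‖ ^ 2)⁻¹)) (ξ, η) ≤
      ENNReal.ofReal (4 * π * (‖η‖ * W η)) := by
    intro η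
    have e : ∀ ξ : E3, Set.indicator {p : E3 × E3 | ‖p.1‖ < ‖p.2‖}
      (fun p => ENNReal.ofReal (W p.2 * (‖p.1‖ ^ 2)⁻¹)) (ξ, η) =
      Set.indicator (Metric.ball 0 ‖η‖) (fun ξ => ENNReal.ofReal (W η) * ENNReal.ofReal ((‖ξ‖ ^ 2)⁻¹)) ξ := by
      intro ξ; simp only [Set.indicator, Set.mem_ofPred_eq, mem_ball_zero_iff, ENNReal.ofReal_mul (hW0 η)]
    simp only [e]
    rw [lintegral_indicator measurableSet_ball, lintegral_const_mul _ (by fun_prop)]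
    refine (mul_le_mul_right (lint_ball _ (norm_nonneg η)) _).trans (le_of_eq ?_)
    rw [← ENNReal.ofReal_mul (hW0 η)]
    congr 1; ring
  refine (lintegral_mono this).trans (le_of_eq ?_)
  rw [← ofReal_integral_eq_lintegral_ofReal (iW.const_mul _)
    (Filter.Eventually.of_forall fun x => mul_nonneg (by positivity) (mul_nonneg (norm_nonneg _) (hW0 x))),
    integral_const_mul]

lemma ptw (F Wa Wb r l : ℝ) (hF : 0 ≤ F) (ha : 0 ≤ Wa) (hb : 0 ≤ Wb) (hl : 0 < l) :
    r⁻¹ * (√F * √Wa * √Wb) ≤ l / 2 * (F * Wb) + l⁻¹ / 2 * (Wa * (r ^ 2)⁻¹) := by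
  have h1 := Real.sq_sqrt hF
  have h2 := Real.sq_sqrt ha
  have h3 := Real.sq_sqrt hb
  have h4 : 0 ≤ l⁻¹ / 2 * (l * (√F * √Wb) - √Wa * r⁻¹) ^ 2 := by positivity
  have e : l⁻¹ / 2 * (l * (√F * √Wb) - √Wa * r⁻¹) ^ 2 =
    l / 2 * (√F ^ 2 * √Wb ^ 2) + l⁻¹ / 2 * (√Wa ^ 2 * (r ^ 2)⁻¹) - r⁻¹ * (√F * √Wa * √Wb) := by
    rw [← inv_pow]
    field_simp
    ring
  rw [e, h1, h2, h3] at h4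
  linarith

lemma main_bd (hF : Continuous F) (hW : Continuous W) (hF0 : ∀ x, 0 ≤ F x) (hW0 : ∀ x, 0 ≤ W x)
    (iF : Integrable F) (iW : Integrable W) (iW' : Integrable (fun x => ‖x‖ * W x)) (l : ℝ) (hl : 0 < l) :
    ∫⁻ p : E3 × E3, ENNReal.ofReal (‖p.1‖⁻¹ * (√(F (p.1 - p.2)) * √(W p.1) * √(W p.2))) ∂(volume.prod volume)
      ≤ ENNReal.ofReal (l * ((∫ x, F x) * ∫ x, W x) + 8 * π / 3 * l⁻¹ * ∫ x, ‖x‖ * W x) := by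
  have hpt : ∀ p : E3 × E3, ENNReal.ofReal (‖p.1‖⁻¹ * (√(F (p.1 - p.2)) * √(W p.1) * √(W p.2))) ≤
      (ENNReal.ofReal (l / 2) * (ENNReal.ofReal (F (p.1 - p.2)) * ENNReal.ofReal (W p.2))
      + ENNReal.ofReal (l / 2) * (ENNReal.ofReal (F (p.1 - p.2)) * ENNReal.ofReal (W p.1)))
      + (ENNReal.ofReal (l⁻¹ / 2) * Set.indicator {p : E3 × E3 | ‖p.2‖ ≤ ‖p.1‖}
          (fun p => ENNReal.ofReal (W p.1 * (‖p.1‖ ^ 2)⁻¹)) p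
      + ENNReal.ofReal (l⁻¹ / 2) * Set.indicator {p : E3 × E3 | ‖p.1‖ < ‖p.2‖}
          (fun p => ENNReal.ofReal (W p.2 * (‖p.1‖ ^ 2)⁻¹)) p) := by
    intro p
    have hl2 : 0 ≤ l / 2 := by positivity
    have hl3 : 0 ≤ l⁻¹ / 2 := by positivity
    rcases le_or_gt ‖p.2‖ ‖p.1‖ with h | h
    · have := ptw (F (p.1 - p.2)) (W p.1) (W p.2) ‖p.1‖ l (hF0 _) (hW0 _) (hW0 _) hl
      rw [Set.indicator_of_mem (by exact h)]
      refine le_trans ?_ (add_le_add (le_self_add) (le_self_add))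
      rw [← ENNReal.ofReal_mul (hF0 _), ← ENNReal.ofReal_mul hl2, ← ENNReal.ofReal_mul hl3,
        ← ENNReal.ofReal_add (mul_nonneg hl2 (mul_nonneg (hF0 _) (hW0 _)))
          (mul_nonneg hl3 (mul_nonneg (hW0 _) (by positivity)))]
      exact ENNReal.ofReal_le_ofReal this
    · have := ptw (F (p.1 - p.2)) (W p.2) (W p.1) ‖p.1‖ l (hF0 _) (hW0 _) (hW0 _) hl
      rw [Set.indicator_of_mem (s := {p : E3 × E3 | ‖p.1‖ < ‖p.2‖}) (by exact h)]
      refine le_trans ?_ (add_le_add (le_add_self) (le_add_self))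
      rw [← ENNReal.ofReal_mul (hF0 _), ← ENNReal.ofReal_mul hl2, ← ENNReal.ofReal_mul hl3,
        ← ENNReal.ofReal_add (mul_nonneg hl2 (mul_nonneg (hF0 _) (hW0 _)))
          (mul_nonneg hl3 (mul_nonneg (hW0 _) (by positivity)))]
      refine ENNReal.ofReal_le_ofReal (le_trans (le_of_eq ?_) this)
      ring
  have hm3 : MeasurableSet {p : E3 × E3 | ‖p.2‖ ≤ ‖p.1‖} := measurableSet_le (by fun_prop) (by fun_prop)
  have hm4 : MeasurableSet {p : E3 × E3 | ‖p.1‖ < ‖p.2‖} := measurableSet_lt (by fun_prop) (by fun_prop)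
  have m3 : Measurable (Set.indicator {p : E3 × E3 | ‖p.2‖ ≤ ‖p.1‖}
          (fun p : E3 × E3 => ENNReal.ofReal (W p.1 * (‖p.1‖ ^ 2)⁻¹))) := Measurable.indicator (by fun_prop) hm3
  have m4 : Measurable (Set.indicator {p : E3 × E3 | ‖p.1‖ < ‖p.2‖}
          (fun p : E3 × E3 => ENNReal.ofReal (W p.2 * (‖p.1‖ ^ 2)⁻¹))) := Measurable.indicator (by fun_prop) hm4
  refine (lintegral_mono hpt).trans ?_
  rw [lintegral_add_left (by fun_prop), lintegral_add_left (by fun_prop), lintegral_add_left (by fun_prop),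
    lintegral_const_mul _ (by fun_prop), lintegral_const_mul _ (by fun_prop),
    lintegral_const_mul _ m3, lintegral_const_mul _ m4,
    ofReal_mul4 hF hW hF0 hW0 iF iW, ofReal_mul5 hF hW hF0 hW0 iF iW]
  have hA : 0 ≤ ∫ x, F x := integral_nonneg hF0
  have hZ : 0 ≤ ∫ x, W x := integral_nonneg hW0
  have hY : 0 ≤ ∫ x, ‖x‖ * W x := integral_nonneg fun x => mul_nonneg (norm_nonneg _) (hW0 x)
  refine (add_le_add le_rfl (add_le_add (mul_le_mul_right (lint_I3 hW hW0 iW') _)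
    (mul_le_mul_right (lint_I4 hW hW0 iW') _))).trans (le_of_eq ?_)
  rw [← ENNReal.ofReal_mul (by positivity), ← ENNReal.ofReal_mul (by positivity),
    ← ENNReal.ofReal_mul (by positivity), ← ENNReal.ofReal_add (by positivity) (by positivity),
    ← ENNReal.ofReal_add (by positivity) (by positivity), ← ENNReal.ofReal_add (by positivity) (by positivity)]
  congr 1
  ring
end abstract_bound
end part_7

section final_part
variable {u : Fin 3 → 𝓢(E3, ℝ)}

lemma sq_int (f : 𝓢(E3, ℂ)) : Integrable (fun x => ‖f x‖ ^ 2) := by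
  refine ((f.integrable.norm).const_mul (SchwartzMap.seminorm ℝ 0 0 f)).mono'
    (by have := f.continuous; fun_prop) (Filter.Eventually.of_forall fun x => ?_)
  have := SchwartzMap.norm_le_seminorm ℝ f x
  rw [Real.norm_of_nonneg (by positivity), sq]
  gcongr

lemma sq_intR (f : 𝓢(E3, ℝ)) : Integrable (fun x => f x ^ 2) := by
  refine ((f.integrable.norm).const_mul (SchwartzMap.seminorm ℝ 0 0 f)).mono'
    (by have := f.continuous; fun_prop) (Filter.Eventually.of_forall fun x => ?_)
  have := SchwartzMap.norm_le_seminorm ℝ f x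
  rw [norm_pow, sq]
  gcongr

lemma F2_int : Integrable (F2 u) := ((sq_int _).add (sq_int _)).add (sq_int _)
lemma W2_int : Integrable (W2 u) := (sq_int _).add (sq_int _)

lemma F2_cont : Continuous (F2 u) := by
  have h := fun k => (FS (curlS u k)).continuous
  unfold F2
  have h0 := h 0
  have h1 := h 1
  have h2 := h 2
  fun_prop

lemma W2_cont : Continuous (W2 u) := by
  have h := fun k => (FS (curlS u k)).continuous
  unfold W2
  have h0 := h 0
  have h1 := h 1
  fun_prop

lemma F2_nonneg (x : E3) : 0 ≤ F2 u x := by unfold F2; positivity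
lemma W2_nonneg (x : E3) : 0 ≤ W2 u x := by unfold W2; positivity

lemma F2_integral : ∫ x, F2 u x = ∫ x, ∑ k, (curlS u k x) ^ 2 := by
  have e : ∀ x, ∑ k, (curlS u k x) ^ 2 = curlS u 0 x ^ 2 + curlS u 1 x ^ 2 + curlS u 2 x ^ 2 := by
    intro x; rw [Fin.sum_univ_three]
  simp only [e]
  unfold F2
  have i1 : Integrable (fun x => ‖FS (curlS u 0) x‖ ^ 2 + ‖FS (curlS u 1) x‖ ^ 2) :=
    (sq_int _).add (sq_int _)
  have i2 : Integrable (fun x => curlS u 0 x ^ 2 + curlS u 1 x ^ 2) :=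
    (sq_intR _).add (sq_intR _)
  rw [integral_add i1 (sq_int _), integral_add (sq_int _) (sq_int _),
    integral_add i2 (sq_intR _), integral_add (sq_intR _) (sq_intR _),
    plancherel, plancherel, plancherel]

lemma nonlin_bd (hd : DivF u) (l : ℝ) (hl : 0 < l) :
    PR u 0 (NT u 0) + PR u 1 (NT u 1) + (PR u 0 (NST u 0) + PR u 1 (NST u 1)) ≤
    3 / (4 * π) * (l * ((∫ x, F2 u x) * ∫ x, W2 u x) + 8 * π / 3 * l⁻¹ * ∫ x, ‖x‖ * W2 u x) := by
  have iW' : Integrable (fun x => ‖x‖ * W2 u x) := by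
    refine (W2_integrable' (u := u).const_mul (2 * π)⁻¹).congr (Filter.Eventually.of_forall fun x => ?_)
    have := pi_pos
    simp only
    field_simp
  rw [PR_NT, PR_NST]
  have hsw : ∫ p : E3 × E3, (2 * π * ‖p.1‖)⁻¹ * Q1 u p.1 p.2 ∂(volume.prod volume) =
      ∫ p : E3 × E3, (2 * π * ‖p.2‖)⁻¹ * Q1 u p.2 p.1 ∂(volume.prod volume) :=
    (integral_prod_swap (μ := volume) (ν := volume)
      (fun p : E3 × E3 => (2 * π * ‖p.1‖)⁻¹ * Q1 u p.1 p.2)).symm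
  have isw : Integrable (fun p : E3 × E3 => (2 * π * ‖p.2‖)⁻¹ * Q1 u p.2 p.1) (volume.prod volume) :=
    (int_Q1 (u := u)).swap
  have e : ∫ p : E3 × E3, (2 * π * ‖p.1‖)⁻¹ * Q1 u p.1 p.2 ∂(volume.prod volume)
      + ∫ p : E3 × E3, (2 * π * ‖p.1‖)⁻¹ * Q2 u p.1 p.2 ∂(volume.prod volume)
      = ∫ p : E3 × E3, ((1 / 2) * ((2 * π * ‖p.1‖)⁻¹ * Q1 u p.1 p.2 + (2 * π * ‖p.2‖)⁻¹ * Q1 u p.2 p.1)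
        + (2 * π * ‖p.1‖)⁻¹ * Q2 u p.1 p.2) ∂(volume.prod volume) := by
    have i1 : Integrable (fun p : E3 × E3 => (1 / 2) * ((2 * π * ‖p.1‖)⁻¹ * Q1 u p.1 p.2
        + (2 * π * ‖p.2‖)⁻¹ * Q1 u p.2 p.1)) (volume.prod volume) :=
      ((int_Q1 (u := u)).add isw).const_mul _
    rw [integral_add i1 int_Q2, integral_const_mul,
      integral_add int_Q1 isw, ← hsw]
    ring
  rw [e]
  have hA : 0 ≤ ∫ x, F2 u x := integral_nonneg F2_nonneg
  have hZ : 0 ≤ ∫ x, W2 u x := integral_nonneg W2_nonneg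
  have hY : 0 ≤ ∫ x, ‖x‖ * W2 u x := integral_nonneg fun x => mul_nonneg (norm_nonneg _) (W2_nonneg x)
  refine integral_le_of_lintegral (by positivity) ?_
  rw [ENNReal.ofReal_mul (by positivity)]
  refine le_trans ?_ (mul_le_mul_right
    (main_bd F2_cont W2_cont F2_nonneg W2_nonneg F2_int W2_int iW' l hl) _)
  have hc := F2_cont (u := u)
  have hc' := W2_cont (u := u)
  rw [← lintegral_const_mul _ (by fun_prop)]
  refine lintegral_mono fun p => ?_
  rw [← ENNReal.ofReal_mul (by positivity)]
  apply ENNReal.ofReal_le_ofReal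
  have h1 := T1_bd hd p.1 p.2
  have h2 := mul_le_mul_of_nonneg_left (Q2_bd hd p.1 p.2) (by positivity : 0 ≤ (2 * π * ‖p.1‖)⁻¹)
  have e2 : 3 / (4 * π) * (‖p.1‖⁻¹ * (√(F2 u (p.1 - p.2)) * √(W2 u p.1) * √(W2 u p.2)))
    = (3 / 2) * ((2 * π * ‖p.1‖)⁻¹ * (√(F2 u (p.1 - p.2)) * √(W2 u p.1) * √(W2 u p.2))) := by
    rw [mul_inv, mul_inv]; ring
  rw [e2]
  linarith

lemma interp (A m : ℝ) (hA : 0 ≤ A) (hm : 0 < m) :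
    A * ∫ x, W2 u x ≤ (1 / 2) * (m * A ^ 2 * (∫ ξ, (2 * π * ‖ξ‖)⁻¹ * W2 u ξ)
      + m⁻¹ * ∫ ξ, (2 * π * ‖ξ‖) * W2 u ξ) := by
  rw [← integral_const_mul, ← integral_const_mul, ← integral_const_mul,
    ← integral_add ((W2_integrable u).const_mul _) (W2_integrable'.const_mul _), ← integral_const_mul]
  refine integral_mono (W2_int.const_mul _)
    ((((W2_integrable u).const_mul _).add (W2_integrable'.const_mul _)).const_mul _) fun ξ => ?_
  simp only [Pi.add_apply]
  by_cases h : ξ = 0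
  · rw [h, W2_zero]; simp
  have hr : 0 < 2 * π * ‖ξ‖ := by have := norm_pos_iff.mpr h; positivity
  set r := 2 * π * ‖ξ‖
  have e : (1 / 2) * (m * A ^ 2 * (r⁻¹ * W2 u ξ) + m⁻¹ * (r * W2 u ξ)) - A * W2 u ξ
    = (1 / 2) * (m⁻¹ * r⁻¹) * (m * A - r) ^ 2 * W2 u ξ := by
    field_simp
    ring
  have : 0 ≤ (1 / 2) * (m⁻¹ * r⁻¹) * (m * A - r) ^ 2 * W2 u ξ :=
    mul_nonneg (by positivity) (W2_nonneg ξ)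
  linarith

lemma deriv_bd (hd : DivF u) (ν : ℝ) (hν : 0 < ν) :
    2 * (PR u 0 (NLS ν u 0) + PR u 1 (NLS ν u 1)) ≤
    243 / (128 * π ^ 4 * ν ^ 3) * (∫ x, F2 u x) ^ 2 * ∫ ξ, (2 * π * ‖ξ‖)⁻¹ * W2 u ξ := by
  have hp := pi_pos
  rw [NLS_eq, NLS_eq, PR_add, PR_add, PR_add, PR_add]
  have h1 := PR_Lap (u := u) ν
  set l : ℝ := 3 / (2 * π * ν) with hl
  have hl0 : 0 < l := by positivity
  set m : ℝ := 9 * l / (8 * π * ν) with hm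
  have hm0 : 0 < m := by positivity
  have h2 := nonlin_bd hd l hl0
  have h3 := interp (u := u) (∫ x, F2 u x) m (integral_nonneg F2_nonneg) hm0
  have e : ∫ ξ, (2 * π * ‖ξ‖) * W2 u ξ = 2 * π * ∫ x, ‖x‖ * W2 u x := by
    rw [← integral_const_mul]; congr 1; ext x; ring
  rw [e] at h1 h3
  set A := ∫ x, F2 u x
  set Z := ∫ x, W2 u x
  set y := ∫ x, ‖x‖ * W2 u x
  set X := ∫ ξ, (2 * π * ‖ξ‖)⁻¹ * W2 u ξ
  have h4 := mul_le_mul_of_nonneg_left h3 (by positivity : 0 ≤ 3 / (2 * π) * l)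
  have key : 2 * (-ν * (2 * π * y)) + 2 * (3 / (4 * π) * (8 * π / 3 * l⁻¹ * y))
      + 3 / (2 * π) * l * ((1 / 2) * (m * A ^ 2 * X + m⁻¹ * (2 * π * y)))
      = 243 / (128 * π ^ 4 * ν ^ 3) * A ^ 2 * X := by
    rw [hm, hl]
    field_simp
    ring
  have e5 : 2 * (3 / (4 * π) * (l * (A * Z) + 8 * π / 3 * l⁻¹ * y)) =
    3 / (2 * π) * l * (A * Z) + 2 * (3 / (4 * π) * (8 * π / 3 * l⁻¹ * y)) := by
    field_simp
    ring
  linarith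

lemma const_le (ν : ℝ) (hν : 0 < ν) : 243 / (128 * π ^ 4 * ν ^ 3) ≤ 1 / (R₂ * ν ^ 3) := by
  have hp := pi_pos
  have hs : (1 : ℝ) ≤ √2 := by rw [Real.one_le_sqrt]; norm_num
  have h2 : √2 ^ 2 = 2 := Real.sq_sqrt (by norm_num)
  have h4 : (1 + √2) ^ 4 = 17 + 12 * √2 := by
    linear_combination (√2 ^ 2 + 4 * √2 + 8) * h2
  unfold R₂
  rw [h4]
  rw [div_le_div_iff₀ (by positivity) (by positivity)]
  have e : 243 * (32 * π ^ 4 / (3 * (17 + 12 * √2)) * ν ^ 3)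
    = (2592 / (17 + 12 * √2)) * (π ^ 4 * ν ^ 3) := by field_simp; norm_num
  have h5 : 2592 / (17 + 12 * √2) ≤ 128 := by
    rw [div_le_iff₀ (by positivity)]; linarith
  rw [e]
  have := mul_le_mul_of_nonneg_right h5 (by positivity : 0 ≤ π ^ 4 * ν ^ 3)
  linarith
end final_part

/-- For an admissible solution of the vorticity equation on `[0,T)` with viscosity
`ν > 0`, the function `t ↦ ‖ω_h(t,·)‖²_{Ḣ^{−1/2}}` is differentiable on `[0,T)` with
derivative at most `(1/(R₂ν³))‖ω(t,·)‖⁴_{L²}‖ω_h(t,·)‖²_{Ḣ^{−1/2}}`. -/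
theorem statement9 (ν : ℝ) (hν : 0 < ν) (T : ℝ≥0∞) (hT : 0 < T)
    (sol : AdmissibleSolution ν T) :
    ∀ t ∈ timeSet T, ∃ d : ℝ,
      HasDerivWithinAt (fun s => hsV (-(1 / 2)) (sol.vorth s)) d (timeSet T) t ∧
      d ≤ (1 / (R₂ * ν ^ 3)) * (∫ x : E3, ∑ k, (sol.vort t k x) ^ 2) ^ 2 *
        hsV (-(1 / 2)) (sol.vorth t) := by
  intro t ht
  obtain ⟨t1, h1, hK⟩ := timeSet_nhds ht
  refine ⟨_, HasDerivWithinAt.up ht h1 (hsV_deriv sol hK t ⟨ht.1, h1.le⟩), ?_⟩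
  have hb := deriv_bd (sol_DivF sol ht) ν hν
  rw [F2_integral, ← hsV_eq] at hb
  have eA : ∫ x : E3, ∑ k, (sol.vort t k x) ^ 2 = ∫ x, ∑ k, (curlS (sol.u t) k x) ^ 2 := by
    simp only [AdmissibleSolution.vort, curlS_coe]
  have hX : 0 ≤ hsV (-(1 / 2)) (sol.vorth t) := by
    rw [hsV_eq]
    exact integral_nonneg fun ξ => mul_nonneg (by positivity) (W2_nonneg ξ)
  have ed : (∫ ξ, (2 * π * ‖ξ‖)⁻¹ * (2 * inner ℝ (FS (curlS (sol.u t) 0) ξ) (FS (curlS (sol.u' t) 0) ξ)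
        + 2 * inner ℝ (FS (curlS (sol.u t) 1) ξ) (FS (curlS (sol.u' t) 1) ξ)))
      = 2 * (PR (sol.u t) 0 (NLS ν (sol.u t) 0) + PR (sol.u t) 1 (NLS ν (sol.u t) 1)) := by
    rw [vort_eqS sol ht, vort_eqS sol ht]
    unfold PR
    rw [← integral_add (weighted_integrable _ 0 _) (weighted_integrable _ 1 _), ← integral_const_mul]
    congr 1; ext ξ; ring
  rw [ed, eA]
  refine hb.trans ?_
  have := const_le ν hν
  gcongr
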